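/- (Homogeneity of Schläfli sixes) For any real Schläfli six {L₁,…,L₆}, all six 5-line subconfigurations {L₁,…,L₆}∖{Lᵢ}, i=1,…,6, are pairwise coarse deformation equivalent: for any i,j, the configuration {L₁,…,L₆}∖{Lᵢ} is deformation equivalent either to {L₁,…,L₆}∖{Lⱼ} or to a mirror image of {L₁,…,L₆}∖{Lⱼ}. -/

import Mathlib

open Submodule

abbrev V4 : Type := Fin 4 → ℝ

abbrev PLine : Type := Submodule ℝ V4

def IsLine (P : PLine) : Prop := Module.finrank ℝ P = 2

def Skew (P Q : PLine) : Prop := IsLine P ∧ IsLine Q ∧ P ⊓ Q = ⊥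

def PairwiseSkew {n : ℕ} (L : Fin n → PLine) : Prop :=
  ∀ i j : Fin n, i ≠ j → Skew (L i) (L j)

noncomputable def det2 (a b c d : V4) : ℝ := Matrix.det (Matrix.of ![a, b, c, d])

open Classical in
noncomputable def lk (P Q R : PLine) : ℝ :=
  if h : ∃ v : Fin 6 → V4,
      P = span ℝ {v 0, v 1} ∧ Q = span ℝ {v 2, v 3} ∧ R = span ℝ {v 4, v 5} then
    Real.sign (det2 (h.choose 0) (h.choose 1) (h.choose 2) (h.choose 3) *
      det2 (h.choose 0) (h.choose 1) (h.choose 4) (h.choose 5) *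
      det2 (h.choose 2) (h.choose 3) (h.choose 4) (h.choose 5))
  else 0

noncomputable def sgnOf {n : ℕ} (L : Fin n → PLine) : ℝ :=
  ∑ i : Fin n, ∑ j : Fin n, ∑ k : Fin n,
    if i < j ∧ j < k then lk (L i) (L j) (L k) else 0

def ContinuousLineFamily (L : ℝ → PLine) : Prop :=
  ∃ v w : ℝ → V4, ContinuousOn v (Set.Icc 0 1) ∧ ContinuousOn w (Set.Icc 0 1) ∧
    ∀ t ∈ Set.Icc (0:ℝ) 1, L t = span ℝ {v t, w t}

def Deformation {n : ℕ} (L L' : Fin n → PLine) : Prop :=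
  ∃ F : ℝ → Fin n → PLine,
    (∀ i, ContinuousLineFamily (fun t => F t i)) ∧
    (∀ t ∈ Set.Icc (0:ℝ) 1, PairwiseSkew (F t)) ∧
    F 0 = L ∧ F 1 = L'

def DeformEquiv {n : ℕ} (L L' : Fin n → PLine) : Prop :=
  ∃ π π' : Equiv.Perm (Fin n), Deformation (L ∘ π) (L' ∘ π')

def IsMirror {n : ℕ} (L L' : Fin n → PLine) : Prop :=
  ∃ A : V4 →ₗ[ℝ] V4, LinearMap.det A < 0 ∧ ∀ i, L' i = (L i).map A

def CoarseDeformEquiv {n : ℕ} (L L' : Fin n → PLine) : Prop :=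
  DeformEquiv L L' ∨ ∃ M : Fin n → PLine, IsMirror L' M ∧ DeformEquiv L M

noncomputable def joinConfig {n : ℕ} (σ : Equiv.Perm (Fin n)) : Fin n → PLine :=
  fun i => span ℝ {![1, (i.val : ℝ) + 1, 0, 0], ![0, 0, ((σ i).val : ℝ) + 1, 1]}

def IsSchlafliSix (L : Fin 6 → PLine) : Prop :=
  PairwiseSkew L ∧
  ∃ F : MvPolynomial (Fin 4) ℝ,
    F ≠ 0 ∧ F.IsHomogeneous 3 ∧
    (∀ i : Fin 6, ∀ x ∈ L i, MvPolynomial.eval x F = 0) ∧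
    (∀ z : Fin 4 → ℂ, z ≠ 0 →
      MvPolynomial.eval z (MvPolynomial.map (algebraMap ℝ ℂ) F) = 0 →
      ∃ j : Fin 4, MvPolynomial.eval z (MvPolynomial.map (algebraMap ℝ ℂ) (MvPolynomial.pderiv j F)) ≠ 0)

def Reducible {n : ℕ} (L : Fin n → PLine) : Prop :=
  ∃ i j : Fin n, i ≠ j ∧ ∃ F : ℝ → Fin n → PLine,
    (∀ k, ContinuousLineFamily (fun t => F t k)) ∧
    F 0 = L ∧
    (∀ t ∈ Set.Ico (0:ℝ) 1, PairwiseSkew (F t)) ∧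
    F 1 i = F 1 j ∧
    (∀ k l : Fin n, k ≠ l → ¬(k = i ∧ l = j) → ¬(k = j ∧ l = i) → Skew (F 1 k) (F 1 l))

lemma det2_eq (a b c d : V4) : det2 a b c d =
    a 0 * (b 1 * (c 2 * d 3 - c 3 * d 2) - b 2 * (c 1 * d 3 - c 3 * d 1)
        + b 3 * (c 1 * d 2 - c 2 * d 1))
      - a 1 * (b 0 * (c 2 * d 3 - c 3 * d 2) - b 2 * (c 0 * d 3 - c 3 * d 0)
        + b 3 * (c 0 * d 2 - c 2 * d 0))
      + a 2 * (b 0 * (c 1 * d 3 - c 3 * d 1) - b 1 * (c 0 * d 3 - c 3 * d 0)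
        + b 3 * (c 0 * d 1 - c 1 * d 0))
      - a 3 * (b 0 * (c 1 * d 2 - c 2 * d 1) - b 1 * (c 0 * d 2 - c 2 * d 0)
        + b 2 * (c 0 * d 1 - c 1 * d 0)) := by
  simp [det2, Matrix.det_succ_row_zero, Fin.sum_univ_succ, Fin.succAbove]
  ring

/-- The linear combination of four vectors with the given coefficients. -/
def comb (f : Fin 4 → V4) (x : V4) : V4 := x 0 • f 0 + x 1 • f 1 + x 2 • f 2 + x 3 • f 3

lemma comb_apply (f : Fin 4 → V4) (x : V4) (i : Fin 4) :
    comb f x i = x 0 * f 0 i + x 1 * f 1 i + x 2 * f 2 i + x 3 * f 3 i := by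
  simp [comb]

lemma det2_comb (f : Fin 4 → V4) (a b c d : V4) :
    det2 (comb f a) (comb f b) (comb f c) (comb f d) =
      det2 a b c d * det2 (f 0) (f 1) (f 2) (f 3) := by
  have h : Matrix.of ![comb f a, comb f b, comb f c, comb f d] =
      Matrix.of ![a, b, c, d] * Matrix.of ![f 0, f 1, f 2, f 3] := by
    ext i j
    fin_cases i <;> simp [Matrix.mul_apply, Fin.sum_univ_four, comb_apply]
  simp only [det2, h, Matrix.det_mul]

lemma det2_swap (a b c d : V4) : det2 c d a b = det2 a b c d := by
  simp only [det2_eq]; ring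

lemma comb_eq_zero {f : Fin 4 → V4} (hf : det2 (f 0) (f 1) (f 2) (f 3) ≠ 0) {x : V4}
    (hx : comb f x = 0) : x = 0 := by
  by_contra hne
  refine hf (Matrix.exists_vecMul_eq_zero_iff.1 ⟨x, hne, ?_⟩)
  rw [← hx]
  ext i
  simp [Matrix.vecMul, dotProduct, Fin.sum_univ_four, comb_apply]

lemma exists_comb_eq {f : Fin 4 → V4} (hf : det2 (f 0) (f 1) (f 2) (f 3) ≠ 0) (y : V4) :
    ∃ x, comb f x = y := by
  let A : V4 →ₗ[ℝ] V4 :=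
    { toFun := comb f
      map_add' := fun x y => by ext i; simp only [comb_apply, Pi.add_apply]; ring
      map_smul' := fun c x => by
        ext i; simp only [comb_apply, Pi.smul_apply, smul_eq_mul, RingHom.id_apply]; ring }
  have hinj : Function.Injective A :=
    (injective_iff_map_eq_zero A).2 fun x hx => comb_eq_zero hf hx
  exact LinearMap.surjective_of_injective hinj y

lemma range_pair (a b : V4) : Set.range ![a, b] = {a, b} := by
  simp [Set.pair_comm]

lemma exists_eq_span_pair {P : PLine} (hP : IsLine P) : ∃ a b : V4, P = span ℝ {a, b} := by
  let B := Module.finBasisOfFinrankEq ℝ P hP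
  refine ⟨B 0, B 1, ?_⟩
  have h := B.span_eq
  have h2 := congrArg (Submodule.map P.subtype) h
  rw [Submodule.map_span, Submodule.map_top, Submodule.range_subtype, ← Set.range_comp] at h2
  refine h2.symm.trans (congrArg (span ℝ) ?_)
  ext x
  simp [Fin.exists_fin_two, eq_comm]

lemma linearIndependent_of_isLine {a b : V4} (h : IsLine (span ℝ {a, b})) :
    LinearIndependent ℝ ![a, b] := by
  rw [linearIndependent_iff_card_eq_finrank_span]
  rw [Fintype.card_fin, Set.finrank, range_pair]
  exact h.symm

lemma isLine_span_pair {a b : V4} (h : LinearIndependent ℝ ![a, b]) :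
    IsLine (span ℝ {a, b}) := by
  have := finrank_span_eq_card h
  rwa [range_pair, Fintype.card_fin] at this

lemma skew_of_det2_ne_zero {a b c d : V4} (h : det2 a b c d ≠ 0) :
    Skew (span ℝ {a, b}) (span ℝ {c, d}) := by
  have key : ∀ s t u w : ℝ, s • a + t • b + u • c + w • d = 0 →
      s = 0 ∧ t = 0 ∧ u = 0 ∧ w = 0 := by
    intro s t u w h0
    have := comb_eq_zero (f := ![a, b, c, d]) (x := ![s, t, u, w]) (by simpa using h)
      (by simpa [comb] using h0)
    exact ⟨congrFun this 0, congrFun this 1, congrFun this 2, congrFun this 3⟩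
  refine ⟨isLine_span_pair (LinearIndependent.pair_iff.2 fun s t h0 => ?_),
    isLine_span_pair (LinearIndependent.pair_iff.2 fun s t h0 => ?_), ?_⟩
  · obtain ⟨h1, h2, -⟩ := key s t 0 0 (by simpa using h0)
    exact ⟨h1, h2⟩
  · obtain ⟨-, -, h1, h2⟩ := key 0 0 s t (by simpa using h0)
    exact ⟨h1, h2⟩
  · rw [eq_bot_iff]
    rintro x ⟨hx1, hx2⟩
    obtain ⟨s, t, rfl⟩ := mem_span_pair.1 hx1
    obtain ⟨u, w, hx⟩ := mem_span_pair.1 hx2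
    obtain ⟨h1, h2, -⟩ := key s t (-u) (-w) (by
      have : s • a + t • b + (-u) • c + (-w) • d = (s • a + t • b) - (u • c + w • d) := by module
      rw [this, hx, sub_self])
    simp [h1, h2]

lemma det2_ne_zero_of_inf_eq_bot {a b c d : V4} (hP : IsLine (span ℝ {a, b}))
    (hQ : IsLine (span ℝ {c, d})) (h : span ℝ {a, b} ⊓ span ℝ {c, d} = ⊥) :
    det2 a b c d ≠ 0 := by
  intro h0
  obtain ⟨x, hx, hx0⟩ := Matrix.exists_vecMul_eq_zero_iff.2 h0
  have h1 : (x 0 • a + x 1 • b) + (x 2 • c + x 3 • d) = 0 := by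
    rw [← hx0]
    ext i
    simp [Matrix.vecMul, dotProduct, Fin.sum_univ_four]
    ring
  have h2 : x 0 • a + x 1 • b ∈ span ℝ {a, b} ⊓ span ℝ {c, d} := by
    refine ⟨mem_span_pair.2 ⟨_, _, rfl⟩, ?_⟩
    rw [eq_neg_of_add_eq_zero_left h1]
    exact Submodule.neg_mem _ (mem_span_pair.2 ⟨_, _, rfl⟩)
  rw [h, Submodule.mem_bot] at h2
  rw [h2, zero_add] at h1
  obtain ⟨h3, h4⟩ := LinearIndependent.pair_iff.1 (linearIndependent_of_isLine hP) _ _ h2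
  obtain ⟨h5, h6⟩ := LinearIndependent.pair_iff.1 (linearIndependent_of_isLine hQ) _ _ h1
  apply hx
  ext i
  fin_cases i <;> assumption

lemma span_pair_lincomb {p q : V4} {a b c d : ℝ} (h : a * d - b * c ≠ 0) :
    span ℝ {a • p + b • q, c • p + d • q} = span ℝ {p, q} := by
  apply le_antisymm
  · rw [span_le]
    rintro x (rfl | rfl) <;> exact mem_span_pair.2 ⟨_, _, rfl⟩
  · rw [span_le]
    have hp : (d / (a * d - b * c)) • (a • p + b • q)
        + (-b / (a * d - b * c)) • (c • p + d • q) = p := by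
      ext i
      simp only [Pi.add_apply, Pi.smul_apply, smul_eq_mul, div_eq_mul_inv]
      linear_combination p i * mul_inv_cancel₀ h
    have hq : (-c / (a * d - b * c)) • (a • p + b • q)
        + (a / (a * d - b * c)) • (c • p + d • q) = q := by
      ext i
      simp only [Pi.add_apply, Pi.smul_apply, smul_eq_mul, div_eq_mul_inv]
      linear_combination q i * mul_inv_cancel₀ h
    rintro x (rfl | rfl)
    · exact mem_span_pair.2 ⟨_, _, hp⟩
    · exact mem_span_pair.2 ⟨_, _, hq⟩

open Matrix in
lemma det_mul_minor_of_mul_eq_one {G H : Matrix (Fin 6) (Fin 6) ℝ} (h : G * H = 1)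
    (σ : Equiv.Perm (Fin 6)) :
    G.det * (H.submatrix (σ ∘ Fin.natAdd 3) (σ ∘ Fin.natAdd 3) : Matrix (Fin 3) (Fin 3) ℝ).det =
      (G.submatrix (σ ∘ Fin.castAdd 3) (σ ∘ Fin.castAdd 3) : Matrix (Fin 3) (Fin 3) ℝ).det := by
  let e : Fin 3 ⊕ Fin 3 ≃ Fin 6 := finSumFinEquiv.trans σ
  have hG : (G.submatrix e e).det = G.det := det_submatrix_equiv_self e G
  have hGH : G.submatrix e e * H.submatrix e e = 1 := by
    rw [submatrix_mul_equiv, h, submatrix_one_equiv]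
  rw [← fromBlocks_toBlocks (G.submatrix e e)] at hG hGH
  rw [← fromBlocks_toBlocks (H.submatrix e e), fromBlocks_multiply, ← fromBlocks_one,
    fromBlocks_inj] at hGH
  obtain ⟨-, h12, -, h22⟩ := hGH
  have key := congrArg det (fromBlocks_multiply
    (G.submatrix e e).toBlocks₁₁ (G.submatrix e e).toBlocks₁₂
    (G.submatrix e e).toBlocks₂₁ (G.submatrix e e).toBlocks₂₂
    1 (H.submatrix e e).toBlocks₁₂ 0 (H.submatrix e e).toBlocks₂₂)
  rw [h12, h22, det_mul, hG, det_fromBlocks_zero₂₁, det_one, one_mul, mul_one, mul_zero,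
    add_zero, det_fromBlocks_zero₁₂, det_one, mul_one] at key
  exact key

lemma det_mul_triple_of_mul_eq_one {G H : Matrix (Fin 6) (Fin 6) ℝ} (h : G * H = 1)
    (hG : ∀ k l, G k l = G l k) (hH : ∀ k l, H k l = H l k) (hG0 : ∀ k, G k k = 0)
    (hH0 : ∀ k, H k k = 0) (σ : Equiv.Perm (Fin 6)) :
    G.det * (H (σ 3) (σ 4) * H (σ 4) (σ 5) * H (σ 3) (σ 5)) =
      G (σ 0) (σ 1) * G (σ 1) (σ 2) * G (σ 0) (σ 2) := by
  have key := det_mul_minor_of_mul_eq_one h σ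
  rw [Matrix.det_fin_three, Matrix.det_fin_three] at key
  simp only [Matrix.submatrix_apply, Function.comp_apply, hG0, hH0] at key
  change G.det * (_ - _ - _ + H (σ 3) (σ 4) * H (σ 4) (σ 5) * H (σ 5) (σ 3)
      + H (σ 3) (σ 5) * H (σ 4) (σ 3) * H (σ 5) (σ 4) - _) =
    _ - _ - _ + G (σ 0) (σ 1) * G (σ 1) (σ 2) * G (σ 2) (σ 0)
      + G (σ 0) (σ 2) * G (σ 1) (σ 0) * G (σ 2) (σ 1) - _ at key
  rw [hH (σ 5) (σ 3), hH (σ 4) (σ 3), hH (σ 5) (σ 4), hG (σ 2) (σ 0), hG (σ 1) (σ 0),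
    hG (σ 2) (σ 1)] at key
  linarith

/-- If two symmetric matrices with zero diagonal are mutually inverse, then the two first rows
of the first one are related, up to squares, by products of the other entries. -/
lemma exists_row_relation_of_mul_eq_one {G H : Matrix (Fin 6) (Fin 6) ℝ} (h : G * H = 1)
    (hG : ∀ k l, G k l = G l k) (hH : ∀ k l, H k l = H l k) (hG0 : ∀ k, G k k = 0)
    (hH0 : ∀ k, H k k = 0) (hne : ∀ k l, k ≠ l → G k l ≠ 0) :
    H 0 1 ≠ 0 ∧ ∃ s : ℝ, s ≠ 0 ∧ ∃ r : Fin 6 → ℝ, (∀ k, 2 ≤ k → r k ≠ 0) ∧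
      s * G 2 1 = r 2 ^ 2 * (G 2 3 * G 2 4 * G 2 5) * G 2 0 ∧
      s * G 3 1 = r 3 ^ 2 * (G 2 3 * G 3 4 * G 3 5) * G 3 0 ∧
      s * G 4 1 = r 4 ^ 2 * (G 2 4 * G 3 4 * G 4 5) * G 4 0 ∧
      s * G 5 1 = r 5 ^ 2 * (G 2 5 * G 3 5 * G 4 5) * G 5 0 := by
  have T2 := det_mul_triple_of_mul_eq_one h hG hH hG0 hH0
    (Equiv.ofBijective ![3, 4, 5, 0, 1, 2] (by decide))
  have T3 := det_mul_triple_of_mul_eq_one h hG hH hG0 hH0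
    (Equiv.ofBijective ![2, 4, 5, 0, 1, 3] (by decide))
  have T4 := det_mul_triple_of_mul_eq_one h hG hH hG0 hH0
    (Equiv.ofBijective ![2, 3, 5, 0, 1, 4] (by decide))
  have T5 := det_mul_triple_of_mul_eq_one h hG hH hG0 hH0
    (Equiv.ofBijective ![2, 3, 4, 0, 1, 5] (by decide))
  change G.det * (H 0 1 * H 1 2 * H 0 2) = G 3 4 * G 4 5 * G 3 5 at T2
  change G.det * (H 0 1 * H 1 3 * H 0 3) = G 2 4 * G 4 5 * G 2 5 at T3
  change G.det * (H 0 1 * H 1 4 * H 0 4) = G 2 3 * G 3 5 * G 2 5 at T4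
  change G.det * (H 0 1 * H 1 5 * H 0 5) = G 2 3 * G 3 4 * G 2 4 at T5
  have E : ∀ k l, G k 0 * H 0 l + G k 1 * H 1 l + G k 2 * H 2 l + G k 3 * H 3 l + G k 4 * H 4 l
      + G k 5 * H 5 l = (1 : Matrix (Fin 6) (Fin 6) ℝ) k l := by
    intro k l
    rw [← h, Matrix.mul_apply, Fin.sum_univ_six]
  have N : ∀ {k l}, k ≠ l → G k l ≠ 0 := @fun k l => hne k l
  have n34 : G 3 4 ≠ 0 := N (by decide)
  have n35 : G 3 5 ≠ 0 := N (by decide)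
  have n45 : G 4 5 ≠ 0 := N (by decide)
  have n23 : G 2 3 ≠ 0 := N (by decide)
  have n24 : G 2 4 ≠ 0 := N (by decide)
  have n25 : G 2 5 ≠ 0 := N (by decide)
  have m2 := T2.trans_ne (mul_ne_zero (mul_ne_zero n34 n45) n35)
  have m3 := T3.trans_ne (mul_ne_zero (mul_ne_zero n24 n45) n25)
  have m4 := T4.trans_ne (mul_ne_zero (mul_ne_zero n23 n35) n25)
  have m5 := T5.trans_ne (mul_ne_zero (mul_ne_zero n23 n34) n24)
  simp only [mul_ne_zero_iff] at m2 m3 m4 m5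
  obtain ⟨d0, ⟨h0, a2⟩, b2⟩ := m2
  obtain ⟨-, ⟨-, a3⟩, b3⟩ := m3
  obtain ⟨-, ⟨-, a4⟩, b4⟩ := m4
  obtain ⟨-, ⟨-, a5⟩, b5⟩ := m5
  have Z01 := E 0 1
  have Z21 := E 2 1
  have Z31 := E 3 1
  have Z41 := E 4 1
  have Z51 := E 5 1
  have Z20 := E 2 0
  have Z30 := E 3 0
  have Z40 := E 4 0
  have Z50 := E 5 0
  simp only [hG0, hH0, zero_mul, mul_zero, zero_add, add_zero, hG 3 2, hG 4 2, hG 5 2, hG 4 3,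
    hG 5 3, hG 5 4, hG 0 2, hG 0 3, hG 0 4, hG 0 5, hH 1 0, hH 2 0, hH 3 0, hH 4 0, hH 5 0, hH 2 1,
    hH 3 1, hH 4 1, hH 5 1, Matrix.one_apply_ne (show (0 : Fin 6) ≠ 1 by decide),
    Matrix.one_apply_ne (show (2 : Fin 6) ≠ 1 by decide),
    Matrix.one_apply_ne (show (3 : Fin 6) ≠ 1 by decide),
    Matrix.one_apply_ne (show (4 : Fin 6) ≠ 1 by decide),
    Matrix.one_apply_ne (show (5 : Fin 6) ≠ 1 by decide),
    Matrix.one_apply_ne (show (2 : Fin 6) ≠ 0 by decide),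
    Matrix.one_apply_ne (show (3 : Fin 6) ≠ 0 by decide),
    Matrix.one_apply_ne (show (4 : Fin 6) ≠ 0 by decide),
    Matrix.one_apply_ne (show (5 : Fin 6) ≠ 0 by decide)]
    at Z01 Z21 Z31 Z41 Z51 Z20 Z30 Z40 Z50
  generalize G.det = d at *
  generalize H 0 1 = h at *
  generalize H 1 2 = x2, H 1 3 = x3, H 1 4 = x4, H 1 5 = x5 at *
  generalize H 0 2 = y2, H 0 3 = y3, H 0 4 = y4, H 0 5 = y5 at *
  have P : G 2 3 * x2 * x3 + G 2 4 * x2 * x4 + G 2 5 * x2 * x5 + G 3 4 * x3 * x4 + G 3 5 * x3 * x5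
      + G 4 5 * x4 * x5 = 0 := by
    linear_combination (x2 * Z21 + x3 * Z31 + x4 * Z41 + x5 * Z51 - h * Z01) / 2
  refine ⟨h0, -(d * h) * (x2 * x3 * x4 * x5), ?_, ![0, 0, x2, x3, x4, x5], ?_, ?_, ?_, ?_, ?_⟩
  · simp only [neg_ne_zero, mul_ne_zero_iff]
    tauto
  · intro k hk
    fin_cases k <;> first | exact absurd hk (by decide) | assumption
  all_goals
    apply mul_left_cancel₀ h0
    simp only [Matrix.cons_val]
  · linear_combination (-d * h * x2 * x3 * x4 * x5) * Z20 + x2 * (G 2 3 * x4 * x5 * T3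
      + G 2 4 * x3 * x5 * T4 + G 2 5 * x3 * x4 * T5) + x2 * (G 2 3 * G 2 4 * G 2 5) * P
      - x2 ^ 2 * (G 2 3 * G 2 4 * G 2 5) * Z21
  · linear_combination (-d * h * x2 * x3 * x4 * x5) * Z30 + x3 * (G 2 3 * x4 * x5 * T2
      + G 3 4 * x2 * x5 * T4 + G 3 5 * x2 * x4 * T5) + x3 * (G 2 3 * G 3 4 * G 3 5) * P
      - x3 ^ 2 * (G 2 3 * G 3 4 * G 3 5) * Z31
  · linear_combination (-d * h * x2 * x3 * x4 * x5) * Z40 + x4 * (G 2 4 * x3 * x5 * T2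
      + G 3 4 * x2 * x5 * T3 + G 4 5 * x2 * x3 * T5) + x4 * (G 2 4 * G 3 4 * G 4 5) * P
      - x4 ^ 2 * (G 2 4 * G 3 4 * G 4 5) * Z41
  · linear_combination (-d * h * x2 * x3 * x4 * x5) * Z50 + x5 * (G 2 5 * x3 * x4 * T2
      + G 3 5 * x2 * x4 * T3 + G 4 5 * x2 * x3 * T4) + x5 * (G 2 5 * G 3 5 * G 4 5) * P
      - x5 ^ 2 * (G 2 5 * G 3 5 * G 4 5) * Z51

/-- Plücker coordinates of the line spanned by two vectors. -/
def plucker (a b : V4) : Fin 6 → ℝ :=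
  ![a 0 * b 1 - a 1 * b 0, a 0 * b 2 - a 2 * b 0, a 0 * b 3 - a 3 * b 0,
    a 1 * b 2 - a 2 * b 1, a 1 * b 3 - a 3 * b 1, a 2 * b 3 - a 3 * b 2]

/-- The matrix of the Plücker quadric. -/
def pluckerForm : Matrix (Fin 6) (Fin 6) ℝ :=
  !![0, 0, 0, 0, 0, 1; 0, 0, 0, 0, -1, 0; 0, 0, 0, 1, 0, 0;
    0, 0, 1, 0, 0, 0; 0, -1, 0, 0, 0, 0; 1, 0, 0, 0, 0, 0]

lemma pluckerForm_mul_self : pluckerForm * pluckerForm = 1 := by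
  ext i j
  fin_cases i <;> fin_cases j <;> simp [pluckerForm, Matrix.mul_apply, Fin.sum_univ_six]

open Matrix in
lemma plucker_mul_form_mul_transpose (a b c d : Fin 6 → V4) (k l : Fin 6) :
    (of (fun k => plucker (a k) (b k)) * pluckerForm * (of fun l => plucker (c l) (d l))ᵀ) k l =
      det2 (a k) (b k) (c l) (d l) := by
  rw [det2_eq]
  simp only [mul_apply, Fin.sum_univ_six, pluckerForm, plucker, transpose_apply, of_apply,
    cons_val]
  ring

open Matrix in
/-- The relation between the linking coefficients of the two five-line subconfigurations of a
double six obtained by omitting the line `0` or the line `1`. -/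
lemma doubleSix_relation {a b c d : Fin 6 → V4}
    (hW : ∀ k l, det2 (a k) (b k) (c l) (d l) = 0 ↔ k ≠ l) {g : Fin 6 → Fin 6 → ℝ}
    (hg : ∀ k l, det2 (a k) (b k) (a l) (b l) = g k l) (hne : ∀ k l, k ≠ l → g k l ≠ 0) :
    det2 (c 0) (d 0) (c 1) (d 1) ≠ 0 ∧
    ∃ s : ℝ, s ≠ 0 ∧ ∃ r : Fin 6 → ℝ, (∀ k, 2 ≤ k → r k ≠ 0) ∧
      s * g 2 1 = r 2 ^ 2 * (g 2 3 * g 2 4 * g 2 5) * g 2 0 ∧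
      s * g 3 1 = r 3 ^ 2 * (g 2 3 * g 3 4 * g 3 5) * g 3 0 ∧
      s * g 4 1 = r 4 ^ 2 * (g 2 4 * g 3 4 * g 4 5) * g 4 0 ∧
      s * g 5 1 = r 5 ^ 2 * (g 2 5 * g 3 5 * g 4 5) * g 5 0 := by
  set W : Matrix (Fin 6) (Fin 6) ℝ := of fun k => plucker (a k) (b k)
  set U : Matrix (Fin 6) (Fin 6) ℝ := of fun k => plucker (c k) (d k)
  set K := pluckerForm
  have KK : K * K = 1 := pluckerForm_mul_self
  have KT : Kᵀ = K := by
    ext i j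
    fin_cases i <;> fin_cases j <;> simp [K, pluckerForm]
  set δ : Fin 6 → ℝ := fun k => det2 (a k) (b k) (c k) (d k)
  have hδ : ∀ k, δ k ≠ 0 := fun k h => (hW k k).1 h rfl
  have hWU : W * K * Uᵀ = diagonal δ := by
    ext k l
    rw [plucker_mul_form_mul_transpose]
    by_cases hkl : k = l
    · subst hkl; rw [diagonal_apply_eq]
    · rw [diagonal_apply_ne _ hkl]; exact (hW k l).2 hkl
  have hUW : U * K * Wᵀ = diagonal δ := by
    rw [← diagonal_transpose, ← hWU, transpose_mul, transpose_mul, transpose_transpose, KT,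
      Matrix.mul_assoc]
  set Δ : Matrix (Fin 6) (Fin 6) ℝ := diagonal fun k => (δ k)⁻¹
  have hΔ : diagonal δ * Δ = 1 := by
    rw [diagonal_mul_diagonal, ← diagonal_one]
    exact congrArg _ (funext fun k => mul_inv_cancel₀ (hδ k))
  have hΔ' : Δ * diagonal δ = 1 := mul_eq_one_comm.1 hΔ
  have h1 : Wᵀ * (Δ * U) = K := by
    have h2 : (Δ * U * K) * Wᵀ = 1 := by rw [Matrix.mul_assoc, Matrix.mul_assoc, ← Matrix.mul_assoc U, hUW, hΔ']
    have h3 := mul_eq_one_comm.1 h2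
    calc Wᵀ * (Δ * U) = Wᵀ * (Δ * U * K) * K := by
          rw [Matrix.mul_assoc, Matrix.mul_assoc (Δ * U), KK, Matrix.mul_one]
      _ = K := by rw [h3, Matrix.one_mul]
  have hGH : (W * K * Wᵀ) * (Δ * (U * K * Uᵀ) * Δ) = 1 := by
    calc (W * K * Wᵀ) * (Δ * (U * K * Uᵀ) * Δ) = W * K * (Wᵀ * (Δ * U)) * K * Uᵀ * Δ := by
          simp only [Matrix.mul_assoc]
      _ = W * K * (K * K) * Uᵀ * Δ := by rw [h1]; simp only [Matrix.mul_assoc]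
      _ = 1 := by rw [KK, Matrix.mul_one, hWU, hΔ]
  have hGapp : ∀ k l, (W * K * Wᵀ) k l = g k l := fun k l => by
    rw [plucker_mul_form_mul_transpose, hg]
  have hHapp : ∀ k l, (Δ * (U * K * Uᵀ) * Δ) k l =
      (δ k)⁻¹ * det2 (c k) (d k) (c l) (d l) * (δ l)⁻¹ := fun k l => by
    rw [mul_diagonal, diagonal_mul, plucker_mul_form_mul_transpose]
  have h0 : ∀ a b : V4, det2 a b a b = 0 := fun a b => by rw [det2_eq]; ring
  obtain ⟨hh, hs⟩ := exists_row_relation_of_mul_eq_one hGH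
    (fun k l => by rw [hGapp, hGapp, ← hg, ← hg, det2_swap])
    (fun k l => by rw [hHapp, hHapp, det2_swap]; ring)
    (fun k => by rw [hGapp, ← hg, h0]) (fun k => by rw [hHapp, h0]; ring)
    (fun k l hkl => by rw [hGapp]; exact hne k l hkl)
  refine ⟨fun h => hh (by rw [hHapp, h]; ring), ?_⟩
  simpa only [hGapp] using hs

/-- Five pairs of vectors spanning pairwise skew lines. -/
def skewFrames : Set (Fin 5 → V4 × V4) :=
  {f | ∀ i j, i ≠ j → det2 (f i).1 (f i).2 (f j).1 (f j).2 ≠ 0}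

/-- The lines spanned by the given pairs of vectors. -/
def spans (f : Fin 5 → V4 × V4) : Fin 5 → PLine := fun i => span ℝ {(f i).1, (f i).2}

/-- Two ordered configurations are isotopic if they have frames joined by a path of frames of
configurations of skew lines. -/
def Isotopic (L L' : Fin 5 → PLine) : Prop :=
  ∃ f g, spans f = L ∧ spans g = L' ∧ JoinedIn skewFrames f g

/-- Changing each of five pairs of vectors by a constant matrix. -/
def changeFrame (A : Fin 5 → Fin 4 → ℝ) (f : Fin 5 → V4 × V4) : Fin 5 → V4 × V4 := fun i =>
  (A i 0 • (f i).1 + A i 1 • (f i).2, A i 2 • (f i).1 + A i 3 • (f i).2)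

lemma continuous_changeFrame (A : Fin 5 → Fin 4 → ℝ) : Continuous (changeFrame A) := by
  unfold changeFrame
  fun_prop

lemma det2_lincomb (p q r s : V4) (a b c d a' b' c' d' : ℝ) :
    det2 (a • p + b • q) (c • p + d • q) (a' • r + b' • s) (c' • r + d' • s) =
      (a * d - b * c) * (a' * d' - b' * c') * det2 p q r s := by
  simp only [det2_eq, Pi.add_apply, Pi.smul_apply, smul_eq_mul]
  ring

lemma det2_changeFrame (A : Fin 5 → Fin 4 → ℝ) (f : Fin 5 → V4 × V4) (i j : Fin 5) :
    det2 (changeFrame A f i).1 (changeFrame A f i).2 (changeFrame A f j).1 (changeFrame A f j).2 =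
      (A i 0 * A i 3 - A i 1 * A i 2) * (A j 0 * A j 3 - A j 1 * A j 2) *
        det2 (f i).1 (f i).2 (f j).1 (f j).2 :=
  det2_lincomb _ _ _ _ _ _ _ _ _ _ _ _

lemma exists_changeFrame {f g : Fin 5 → V4 × V4} (hf : f ∈ skewFrames) (h : spans f = spans g) :
    ∃ A : Fin 5 → Fin 4 → ℝ, (∀ i, A i 0 * A i 3 - A i 1 * A i 2 ≠ 0) ∧ changeFrame A g = f := by
  have h1 : ∀ i, ∃ A : Fin 4 → ℝ, (f i).1 = A 0 • (g i).1 + A 1 • (g i).2 ∧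
      (f i).2 = A 2 • (g i).1 + A 3 • (g i).2 := by
    intro i
    have hi : span ℝ {(f i).1, (f i).2} = span ℝ {(g i).1, (g i).2} := congrFun h i
    have m1 : (f i).1 ∈ span ℝ {(g i).1, (g i).2} := hi ▸ subset_span (Set.mem_insert _ _)
    have m2 : (f i).2 ∈ span ℝ {(g i).1, (g i).2} :=
      hi ▸ subset_span (Set.mem_insert_of_mem _ rfl)
    obtain ⟨a, b, h1⟩ := mem_span_pair.1 m1
    obtain ⟨c, d, h2⟩ := mem_span_pair.1 m2
    exact ⟨![a, b, c, d], h1.symm, h2.symm⟩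
  choose A hA1 hA2 using h1
  have hA : changeFrame A g = f := funext fun i => Prod.ext (hA1 i).symm (hA2 i).symm
  refine ⟨A, fun i h0 => ?_, hA⟩
  obtain ⟨j, hj⟩ := exists_ne i
  apply hf i j hj.symm
  rw [← hA, det2_changeFrame, h0]
  ring

lemma spans_changeFrame {A : Fin 5 → Fin 4 → ℝ} (hA : ∀ i, A i 0 * A i 3 - A i 1 * A i 2 ≠ 0)
    (f : Fin 5 → V4 × V4) : spans (changeFrame A f) = spans f :=
  funext fun i => span_pair_lincomb (hA i)

lemma JoinedIn.changeFrame {f g : Fin 5 → V4 × V4} (h : JoinedIn skewFrames f g)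
    {A : Fin 5 → Fin 4 → ℝ} (hA : ∀ i, A i 0 * A i 3 - A i 1 * A i 2 ≠ 0) :
    JoinedIn skewFrames (changeFrame A f) (changeFrame A g) := by
  refine (h.map (continuous_changeFrame A)).mono ?_
  rintro _ ⟨f, hf, rfl⟩ i j hij
  rw [det2_changeFrame]
  exact mul_ne_zero (mul_ne_zero (hA i) (hA j)) (hf i j hij)

lemma Isotopic.symm {L L' : Fin 5 → PLine} (h : Isotopic L L') : Isotopic L' L := by
  obtain ⟨f, g, hf, hg, h⟩ := h
  exact ⟨g, f, hg, hf, h.symm⟩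

lemma Isotopic.trans {L L' L'' : Fin 5 → PLine} (h : Isotopic L L') (h' : Isotopic L' L'') :
    Isotopic L L'' := by
  obtain ⟨f, g, hf, hg, h⟩ := h
  obtain ⟨g', k, hg', hk, h'⟩ := h'
  obtain ⟨A, hA, rfl⟩ := exists_changeFrame h.target_mem (hg.trans hg'.symm)
  exact ⟨f, changeFrame A k, hf, (spans_changeFrame hA k).trans hk, h.trans (h'.changeFrame hA)⟩

lemma isotopic_of_eq {L L' : Fin 5 → PLine} {f : Fin 5 → V4 × V4} (hf : f ∈ skewFrames)
    (h : spans f = L) (h' : L = L') : Isotopic L L' :=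
  ⟨f, f, h, h.trans h', JoinedIn.refl hf⟩

lemma Isotopic.comp {L L' : Fin 5 → PLine} (h : Isotopic L L') (π : Equiv.Perm (Fin 5)) :
    Isotopic (L ∘ π) (L' ∘ π) := by
  obtain ⟨f, g, rfl, rfl, h⟩ := h
  refine ⟨f ∘ π, g ∘ π, rfl, rfl, (h.map (f := fun f => f ∘ π) (by fun_prop)).mono ?_⟩
  rintro _ ⟨f, hf, rfl⟩ i j hij
  exact hf _ _ (π.injective.ne hij)

/-- The linear map with the given values on the standard basis. -/
def combMap (f : Fin 4 → V4) : V4 →ₗ[ℝ] V4 where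
  toFun := comb f
  map_add' x y := by ext i; simp only [comb_apply, Pi.add_apply]; ring
  map_smul' c x := by
    ext i; simp only [comb_apply, Pi.smul_apply, smul_eq_mul, RingHom.id_apply]; ring

lemma combMap_apply (f : Fin 4 → V4) (x : V4) : combMap f x = comb f x := rfl

lemma map_spans (A : V4 →ₗ[ℝ] V4) (f : Fin 5 → V4 × V4) :
    (fun i => (spans f i).map A) = spans fun i => (A (f i).1, A (f i).2) := by
  funext i
  rw [spans, spans, Submodule.map_span, Set.image_pair]

lemma Isotopic.map {L L' : Fin 5 → PLine} (h : Isotopic L L') {f : Fin 4 → V4}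
    (hf : det2 (f 0) (f 1) (f 2) (f 3) ≠ 0) :
    Isotopic (fun i => (L i).map (combMap f)) (fun i => (L' i).map (combMap f)) := by
  obtain ⟨g, k, rfl, rfl, h⟩ := h
  have hc : Continuous (combMap f) := (combMap f).continuous_of_finiteDimensional
  refine ⟨_, _, (map_spans _ g).symm, (map_spans _ k).symm,
    (h.map (f := fun (g : Fin 5 → V4 × V4) i => (combMap f (g i).1, combMap f (g i).2))
      (by fun_prop)).mono ?_⟩
  rintro _ ⟨g, hg, rfl⟩ i j hij
  simp only [combMap_apply, det2_comb]
  exact mul_ne_zero (hg i j hij) hf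

lemma Isotopic.deformation {L L' : Fin 5 → PLine} (h : Isotopic L L') : Deformation L L' := by
  obtain ⟨f, g, rfl, rfl, γ, hγ⟩ := h
  refine ⟨fun t => spans (γ.extend t), fun i => ⟨fun t => (γ.extend t i).1,
    fun t => (γ.extend t i).2, ?_, ?_, fun t _ => rfl⟩, fun t ht i j hij => ?_, ?_, ?_⟩
  · exact Continuous.continuousOn
      (continuous_fst.comp ((continuous_apply i).comp γ.continuous_extend))
  · exact Continuous.continuousOn
      (continuous_snd.comp ((continuous_apply i).comp γ.continuous_extend))
  · refine skew_of_det2_ne_zero ?_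
    rw [γ.extend_apply ht]
    exact hγ _ i j hij
  · simp
  · simp

/-- The orientation reversing reflection in the second coordinate, as a basis. -/
def reflBasis : Fin 4 → V4 := ![![1, 0, 0, 0], ![0, -1, 0, 0], ![0, 0, 1, 0], ![0, 0, 0, 1]]

lemma det2_reflBasis : det2 (reflBasis 0) (reflBasis 1) (reflBasis 2) (reflBasis 3) = -1 := by
  simp [det2_eq, reflBasis]

lemma det2_reflBasis_ne_zero :
    det2 (reflBasis 0) (reflBasis 1) (reflBasis 2) (reflBasis 3) ≠ 0 := by
  rw [det2_reflBasis]; norm_num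

lemma det_combMap (f : Fin 4 → V4) :
    LinearMap.det (combMap f) = det2 (f 0) (f 1) (f 2) (f 3) := by
  rw [← LinearMap.det_toMatrix', det2, ← Matrix.det_transpose]
  congr 1
  ext i j
  rw [Matrix.transpose_apply, LinearMap.toMatrix'_apply, combMap_apply, comb_apply]
  fin_cases i <;> simp

/-- The reflection of a configuration of lines. -/
noncomputable def mirrorConfig (L : Fin 5 → PLine) : Fin 5 → PLine :=
  fun i => (L i).map (combMap reflBasis)

lemma combMap_reflBasis_comp_self : combMap reflBasis ∘ₗ combMap reflBasis = LinearMap.id := by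
  ext i j
  fin_cases i <;> fin_cases j <;> simp [combMap_apply, comb_apply, reflBasis]

lemma mirrorConfig_mirrorConfig (L : Fin 5 → PLine) : mirrorConfig (mirrorConfig L) = L := by
  funext i
  rw [mirrorConfig, mirrorConfig, ← Submodule.map_comp, combMap_reflBasis_comp_self, Submodule.map_id]

lemma Isotopic.reflect {L L' : Fin 5 → PLine} (h : Isotopic L L') :
    Isotopic (mirrorConfig L) (mirrorConfig L') :=
  h.map det2_reflBasis_ne_zero

/-- Isotopy up to reordering and reflection. -/
def CoarselyIsotopic (L L' : Fin 5 → PLine) : Prop :=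
  ∃ π : Equiv.Perm (Fin 5), Isotopic L (L' ∘ π) ∨ Isotopic L (mirrorConfig (L' ∘ π))

lemma Isotopic.coarselyIsotopic {L L' : Fin 5 → PLine} (h : Isotopic L L') :
    CoarselyIsotopic L L' :=
  ⟨1, Or.inl h⟩

lemma CoarselyIsotopic.symm {L L' : Fin 5 → PLine} (h : CoarselyIsotopic L L') :
    CoarselyIsotopic L' L := by
  have hc : ∀ π : Equiv.Perm (Fin 5), (L' ∘ π) ∘ ⇑π⁻¹ = L' := fun π => by
    funext i; simp
  obtain ⟨π, h | h⟩ := h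
  · have := h.symm.comp π⁻¹
    rw [hc] at this
    exact ⟨π⁻¹, Or.inl this⟩
  · have := h.symm.reflect.comp π⁻¹
    rw [mirrorConfig_mirrorConfig, hc] at this
    exact ⟨π⁻¹, Or.inr this⟩

lemma CoarselyIsotopic.trans {L L' L'' : Fin 5 → PLine} (h : CoarselyIsotopic L L')
    (h' : CoarselyIsotopic L' L'') : CoarselyIsotopic L L'' := by
  obtain ⟨π, h⟩ := h
  obtain ⟨π', h'⟩ := h'
  refine ⟨π' * π, ?_⟩
  obtain h | h := h <;> obtain h' | h' := h'
  · exact Or.inl (h.trans (h'.comp π))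
  · exact Or.inr (h.trans (h'.comp π))
  · exact Or.inr (h.trans (h'.comp π).reflect)
  · refine Or.inl (h.trans ?_)
    have := (h'.comp π).reflect
    rwa [show mirrorConfig (mirrorConfig (L'' ∘ π') ∘ π) = mirrorConfig (mirrorConfig ((L'' ∘ π') ∘ π)) from rfl,
      mirrorConfig_mirrorConfig] at this

lemma CoarselyIsotopic.coarseDeformEquiv {L L' C C' : Fin 5 → PLine} (h : CoarselyIsotopic C C')
    {f : Fin 4 → V4} (hf : det2 (f 0) (f 1) (f 2) (f 3) ≠ 0)
    (hL : Isotopic L fun i => (C i).map (combMap f))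
    (hL' : Isotopic L' fun i => (C' i).map (combMap f)) (p q : Equiv.Perm (Fin 5)) :
    CoarseDeformEquiv (L ∘ p) (L' ∘ q) := by
  obtain ⟨π, h | h⟩ := h
  · left
    refine ⟨p⁻¹, q⁻¹ * π, ?_⟩
    have h1 := hL.trans ((h.map hf).trans (hL'.symm.comp π))
    convert h1.deformation using 1 <;> funext i <;> simp
  · right
    let e : V4 ≃ₗ[ℝ] V4 := LinearEquiv.ofBijective (combMap f)
      ⟨(injective_iff_map_eq_zero _).2 fun x hx => comb_eq_zero hf hx, exists_comb_eq hf⟩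
    let A : V4 →ₗ[ℝ] V4 := e.toLinearMap ∘ₗ combMap reflBasis ∘ₗ e.symm.toLinearMap
    have hA : LinearMap.det A = -1 := by
      rw [← det2_reflBasis, ← det_combMap]
      exact LinearMap.det_conj _ e
    have hAe : A ∘ₗ combMap f = combMap f ∘ₗ combMap reflBasis := by
      refine LinearMap.ext fun x => ?_
      change e (combMap reflBasis (e.symm (e x))) = e (combMap reflBasis x)
      rw [e.symm_apply_apply]
    let g : Fin 4 → V4 := fun i => A (Pi.single i 1)
    have hg : combMap g = A := by
      ext i j
      fin_cases i <;> simp [g, combMap_apply, comb_apply]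
    refine ⟨fun i => (L' (q i)).map A, ⟨A, by rw [hA]; norm_num, fun i => rfl⟩, p⁻¹, q⁻¹ * π, ?_⟩
    have hg0 : det2 (g 0) (g 1) (g 2) (g 3) ≠ 0 := by
      rw [← det_combMap, hg, hA]; norm_num
    have h1 := (hL'.symm.comp π).map hg0
    have heq : (fun i => (mirrorConfig (C' ∘ π) i).map (combMap f)) =
        fun i => (((fun i => (C' i).map (combMap f)) ∘ π) i).map (combMap g) := by
      funext i
      simp only [mirrorConfig, Function.comp_apply]
      rw [← Submodule.map_comp, ← Submodule.map_comp, hg, hAe]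
    have h2 := h.map hf
    rw [heq] at h2
    have h3 := hL.trans (h2.trans h1)
    convert h3.deformation using 1 <;> funext i <;> simp [hg]

/-- The vectors `(n, 0)` and `(0, v)`. -/
def prodFrame (n v : Fin 5 → ℝ × ℝ) : Fin 5 → V4 × V4 := fun k =>
  (![(n k).1, (n k).2, 0, 0], ![0, 0, (v k).1, (v k).2])

/-- The determinant of two plane vectors. -/
def bracket (p q : ℝ × ℝ) : ℝ := p.1 * q.2 - p.2 * q.1

lemma det2_prodFrame (n v : Fin 5 → ℝ × ℝ) (k l : Fin 5) :
    det2 (prodFrame n v k).1 (prodFrame n v k).2 (prodFrame n v l).1 (prodFrame n v l).2 =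
      -(bracket (n k) (n l) * bracket (v k) (v l)) := by
  simp [det2_eq, prodFrame, bracket]
  ring

/-- The unit vector with the given angle. -/
noncomputable def unitVec (θ : ℝ) : ℝ × ℝ := (Real.cos θ, Real.sin θ)

lemma bracket_unitVec (θ φ : ℝ) : bracket (unitVec θ) (unitVec φ) = Real.sin (φ - θ) := by
  rw [bracket, unitVec, unitVec, Real.sin_sub]
  ring

/-- The frame with the given angles. -/
noncomputable def polarFrame (θ φ : Fin 5 → ℝ) : Fin 5 → V4 × V4 :=
  prodFrame (fun k => unitVec (θ k)) (fun k => unitVec (φ k))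

lemma polarFrame_mem {θ φ : Fin 5 → ℝ} (hθ : ∀ k l, k ≠ l → Real.sin (θ l - θ k) ≠ 0)
    (hφ : ∀ k l, k ≠ l → Real.sin (φ l - φ k) ≠ 0) : polarFrame θ φ ∈ skewFrames := by
  intro k l hkl
  rw [polarFrame, det2_prodFrame, bracket_unitVec, bracket_unitVec]
  exact neg_ne_zero.2 (mul_ne_zero (hθ k l hkl) (hφ k l hkl))

lemma continuous_polarFrame : Continuous fun p : (Fin 5 → ℝ) × (Fin 5 → ℝ) =>
    polarFrame p.1 p.2 := by
  refine continuous_pi fun k => Continuous.prodMk ?_ ?_ <;>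
  · refine continuous_pi fun i => ?_
    fin_cases i <;> simp [unitVec] <;> fun_prop

/-- Two angular sequences are joined by a segment along which differences stay regular. -/
def AngleJoined (θ θ' : Fin 5 → ℝ) : Prop :=
  ∀ t ∈ Set.Icc (0 : ℝ) 1, ∀ k l, k ≠ l →
    Real.sin ((1 - t) * (θ l - θ k) + t * (θ' l - θ' k)) ≠ 0

lemma isotopic_polarFrame {θ θ' φ φ' : Fin 5 → ℝ} (hθ : AngleJoined θ θ')
    (hφ : AngleJoined φ φ') :
    Isotopic (spans (polarFrame θ φ)) (spans (polarFrame θ' φ')) := by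
  refine ⟨_, _, rfl, rfl, JoinedIn.ofLine (f := fun t =>
    polarFrame (fun k => (1 - t) * θ k + t * θ' k) (fun k => (1 - t) * φ k + t * φ' k))
    (continuous_polarFrame.comp (f := fun t : ℝ => ((fun k => (1 - t) * θ k + t * θ' k),
      (fun k => (1 - t) * φ k + t * φ' k))) (by fun_prop)).continuousOn (by simp) (by simp) ?_⟩
  rintro _ ⟨t, ht, rfl⟩
  refine polarFrame_mem (fun k l hkl => ?_) (fun k l hkl => ?_)
  · convert hθ t ht k l hkl using 2; ring
  · convert hφ t ht k l hkl using 2; ring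

lemma angleJoined_add {θ : Fin 5 → ℝ} (hθ : ∀ k l, k ≠ l → Real.sin (θ l - θ k) ≠ 0) (α : ℝ) :
    AngleJoined θ fun k => θ k + α := by
  intro t _ k l hkl
  convert hθ k l hkl using 2; ring

lemma angleJoined_of_lt_iff {θ θ' : Fin 5 → ℝ} (hθ : ∀ k, θ k ∈ Set.Ico 0 Real.pi)
    (hθ' : ∀ k, θ' k ∈ Set.Ico 0 Real.pi) (hinj : Function.Injective θ)
    (h : ∀ k l, θ k < θ l ↔ θ' k < θ' l) : AngleJoined θ θ' := by
  have key : ∀ t ∈ Set.Icc (0 : ℝ) 1, ∀ k l, θ k < θ l →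
      0 < Real.sin ((1 - t) * (θ l - θ k) + t * (θ' l - θ' k)) := by
    intro t ht k l hkl
    have h' := (h k l).1 hkl
    obtain ⟨t0, t1⟩ := ht
    have := hθ k; have := hθ l; have := hθ' k; have := hθ' l
    simp only [Set.mem_Ico] at *
    apply Real.sin_pos_of_pos_of_lt_pi
    · rcases eq_or_lt_of_le t0 with rfl | t0
      · linarith
      · have := mul_pos t0 (sub_pos.2 h')
        have := mul_nonneg (sub_nonneg.2 t1) (sub_pos.2 hkl).le
        linarith
    · have e1 : θ l - θ k < Real.pi := by linarith
      have e2 : θ' l - θ' k < Real.pi := by linarith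
      rcases eq_or_lt_of_le t0 with rfl | t0
      · linarith
      · have := mul_lt_mul_of_pos_left e2 t0
        have := mul_le_mul_of_nonneg_left e1.le (sub_nonneg.2 t1)
        linarith
  intro t ht k l hkl
  rcases lt_or_gt_of_ne (hinj.ne hkl) with h1 | h1
  · exact (key t ht k l h1).ne'
  · have := key t ht l k h1
    rw [show (1 - t) * (θ l - θ k) + t * (θ' l - θ' k) =
      -((1 - t) * (θ k - θ l) + t * (θ' k - θ' l)) by ring, Real.sin_neg]
    exact (neg_neg_of_pos this).ne

lemma exists_angle {p : ℝ × ℝ} (hp : p ≠ 0) :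
    ∃ θ ∈ Set.Ico 0 Real.pi, ∃ r : ℝ, r ≠ 0 ∧ p = r • unitVec θ := by
  have hz : (⟨p.1, p.2⟩ : ℂ) ≠ 0 := fun h =>
    hp (Prod.ext (congrArg Complex.re h) (congrArg Complex.im h))
  set z : ℂ := ⟨p.1, p.2⟩
  have hn : ‖z‖ ≠ 0 := norm_ne_zero_iff.2 hz
  have h1 : p.1 = ‖z‖ * Real.cos z.arg := (Complex.norm_mul_cos_arg z).symm
  have h2 : p.2 = ‖z‖ * Real.sin z.arg := (Complex.norm_mul_sin_arg z).symm
  have h3 := Complex.neg_pi_lt_arg z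
  have h4 := Complex.arg_le_pi z
  rcases lt_or_ge z.arg 0 with h | h
  · refine ⟨z.arg + Real.pi, ⟨by linarith, by linarith⟩, -‖z‖, neg_ne_zero.2 hn, ?_⟩
    ext <;> simp [unitVec, h1, h2]
  · rcases eq_or_lt_of_le h4 with h5 | h5
    · refine ⟨0, ⟨le_rfl, Real.pi_pos⟩, -‖z‖, neg_ne_zero.2 hn, ?_⟩
      rw [h5] at h1 h2
      ext <;> simp [unitVec, h1, h2]
    · refine ⟨z.arg, ⟨h, h5⟩, ‖z‖, hn, ?_⟩
      ext <;> simp [unitVec, h1, h2]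

lemma sign_sin {x : ℝ} (h1 : -Real.pi < x) (h2 : x < Real.pi) :
    SignType.sign (Real.sin x) = SignType.sign x := by
  rcases lt_trichotomy x 0 with h | rfl | h
  · rw [sign_neg h, sign_neg (Real.sin_neg_of_neg_of_neg_pi_lt h h1)]
  · simp
  · rw [sign_pos h, sign_pos (Real.sin_pos_of_pos_of_lt_pi h h2)]

lemma spans_prodFrame_smul (n v : Fin 5 → ℝ × ℝ) {r s : Fin 5 → ℝ} (hr : ∀ k, r k ≠ 0)
    (hs : ∀ k, s k ≠ 0) :
    spans (prodFrame (fun k => r k • n k) (fun k => s k • v k)) = spans (prodFrame n v) := by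
  rw [← spans_changeFrame (A := fun k => ![r k, 0, 0, s k])
    (fun k => by simpa using ⟨hr k, hs k⟩) (prodFrame n v)]
  congr 1
  funext k
  ext i <;> fin_cases i <;> simp [prodFrame, changeFrame]

/-- The sum over triples of indices of the products of three signs. -/
def tripleSum (ε : Fin 5 → Fin 5 → SignType) : ℤ :=
  ∑ k, ∑ l, ∑ m, ((ε k l * ε l m * ε m k : SignType) : ℤ)

lemma tripleSum_comp (ε : Fin 5 → Fin 5 → SignType) (π : Equiv.Perm (Fin 5)) :
    tripleSum (fun k l => ε (π k) (π l)) = tripleSum ε := by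
  unfold tripleSum
  symm
  rw [← Equiv.sum_comp π]
  refine Finset.sum_congr rfl fun k _ => ?_
  rw [← Equiv.sum_comp π]
  refine Finset.sum_congr rfl fun l _ => ?_
  exact (Equiv.sum_comp π fun m => ((ε (π k) (π l) * ε (π l) m * ε m (π k) : SignType) : ℤ)).symm

/-- The comparison sign of two indices. -/
def cmpSign (a b : Fin 5) : SignType := if a < b then 1 else if b < a then -1 else 0

/-- The signs attached to two orderings. -/
def orderSign (a b : Fin 5 → Fin 5) (k l : Fin 5) : SignType :=
  cmpSign (a k) (a l) * cmpSign (b k) (b l)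

/-- Representatives of the permutations up to cyclic rotations and reversals. -/
def repPerm : Fin 4 → Fin 5 → Fin 5 :=
  ![![0, 1, 2, 3, 4], ![0, 1, 2, 4, 3], ![0, 1, 3, 4, 2], ![0, 2, 4, 1, 3]]

lemma exists_repPerm_of_pairwise_ne : ∀ a b c d e : Fin 5,
    [a, b, c, d, e].Nodup → ∃ i : Fin 4, ∃ r s : Fin 5, ∃ t : Bool,
      (∀ k : Fin 5, ![a, b, c, d, e] (bif t then s - k else s + k) + r = repPerm i k) ∧
      tripleSum (orderSign id ![a, b, c, d, e]) ^ 2 = ![3600, 576, 144, 0] i := by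
  decide +kernel

lemma exists_repPerm (σ : Equiv.Perm (Fin 5)) : ∃ i : Fin 4, ∃ r s : Fin 5, ∃ t : Bool,
    (∀ k : Fin 5, σ (bif t then s - k else s + k) + r = repPerm i k) ∧
      tripleSum (orderSign id σ) ^ 2 = ![3600, 576, 144, 0] i := by
  have h : (σ : Fin 5 → Fin 5) = ![σ 0, σ 1, σ 2, σ 3, σ 4] := by
    ext k; fin_cases k <;> rfl
  rw [h]
  apply exists_repPerm_of_pairwise_ne
  simp [σ.injective.eq_iff]

lemma eq_of_tripleSum_sq_eq {i j : Fin 4}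
    (h : (![3600, 576, 144, 0] : Fin 4 → ℤ) i = ![3600, 576, 144, 0] j) : i = j := by
  revert i j; decide

/-- The frame with angles the given multiples of `π / 5`. -/
noncomputable def latticeFrame (a b : Fin 5 → ℤ) : Fin 5 → V4 × V4 :=
  polarFrame (fun k => a k * (Real.pi / 5)) (fun k => b k * (Real.pi / 5))

lemma sin_int_mul_ne_zero {m : ℤ} (h : ¬ (5 : ℤ) ∣ m) : Real.sin (m * (Real.pi / 5)) ≠ 0 := by
  intro h0
  obtain ⟨n, hn⟩ := Real.sin_eq_zero_iff.1 h0
  apply h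
  refine ⟨n, ?_⟩
  have hp := Real.pi_pos.ne'
  have : (m : ℝ) = 5 * n := by
    apply mul_right_cancel₀ hp
    linear_combination -5 * hn
  exact_mod_cast this

lemma spans_latticeFrame_congr {a a' b b' : Fin 5 → ℤ} (ha : ∀ k, (5 : ℤ) ∣ a' k - a k)
    (hb : ∀ k, (5 : ℤ) ∣ b' k - b k) :
    spans (latticeFrame a b) = spans (latticeFrame a' b') := by
  choose p hp using ha
  choose q hq using hb
  have h : ∀ m m' p : ℤ, m' - m = 5 * p →
      unitVec (m' * (Real.pi / 5)) = ((-1 : ℝ) ^ p) • unitVec (m * (Real.pi / 5)) := by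
    intro m m' p hp
    have : (m' : ℝ) * (Real.pi / 5) = m * (Real.pi / 5) + p * Real.pi := by
      have : (m' : ℝ) - m = 5 * p := by exact_mod_cast hp
      linear_combination Real.pi / 5 * this
    rw [this, unitVec, Real.cos_add_int_mul_pi, Real.sin_add_int_mul_pi]
    rfl
  have hne : ∀ p : ℤ, (-1 : ℝ) ^ p ≠ 0 := fun p => zpow_ne_zero _ (by norm_num)
  symm
  unfold latticeFrame polarFrame
  rw [funext fun k => h _ _ _ (hp k), funext fun k => h _ _ _ (hq k)]
  exact spans_prodFrame_smul _ _ (fun k => hne (p k)) (fun k => hne (q k))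

/-- The sequence of angle multiples is regular. -/
def LatticeRegular (a : Fin 5 → ℤ) : Prop := ∀ k l, k ≠ l → ¬ (5 : ℤ) ∣ a l - a k

lemma LatticeRegular.sin_ne_zero {a : Fin 5 → ℤ} (ha : LatticeRegular a) (k l : Fin 5)
    (hkl : k ≠ l) : Real.sin (a l * (Real.pi / 5) - a k * (Real.pi / 5)) ≠ 0 := by
  rw [← sub_mul]
  exact_mod_cast sin_int_mul_ne_zero (ha k l hkl)

lemma latticeFrame_mem {a b : Fin 5 → ℤ} (ha : LatticeRegular a) (hb : LatticeRegular b) :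
    latticeFrame a b ∈ skewFrames :=
  polarFrame_mem ha.sin_ne_zero hb.sin_ne_zero

lemma latticeRegular_perm (σ : Equiv.Perm (Fin 5)) : LatticeRegular fun k => (σ k : ℤ) := by
  intro k l hkl h
  have := Fin.val_ne_of_ne (σ.injective.ne hkl)
  dsimp only at h
  omega

lemma isotopic_latticeFrame_add {a b : Fin 5 → ℤ} (ha : LatticeRegular a)
    (hb : LatticeRegular b) (p q : ℤ) :
    Isotopic (spans (latticeFrame a b))
      (spans (latticeFrame (fun k => a k + p) (fun k => b k + q))) := by
  have := isotopic_polarFrame (angleJoined_add ha.sin_ne_zero (p * (Real.pi / 5)))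
    (angleJoined_add hb.sin_ne_zero (q * (Real.pi / 5)))
  unfold latticeFrame
  simpa only [Int.cast_add, add_mul] using this

lemma mirrorConfig_latticeFrame (a b : Fin 5 → ℤ) :
    mirrorConfig (spans (latticeFrame a b)) = spans (latticeFrame (fun k => -a k) b) := by
  unfold mirrorConfig
  rw [map_spans]
  congr 1
  funext k
  ext i <;> fin_cases i <;>
    simp [combMap_apply, comb_apply, reflBasis, latticeFrame, polarFrame, prodFrame, unitVec]

lemma CoarselyIsotopic.comp_right {L : Fin 5 → PLine} {f : Fin 5 → V4 × V4}
    (hf : f ∈ skewFrames) (h : spans f = L) (π : Equiv.Perm (Fin 5)) :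
    CoarselyIsotopic (L ∘ π) L :=
  ⟨π, Or.inl (isotopic_of_eq (f := f ∘ π) (fun i j hij => hf _ _ (π.injective.ne hij))
    (by rw [← h]; rfl) rfl)⟩

lemma coarselyIsotopic_repPerm (σ : Equiv.Perm (Fin 5)) {i : Fin 4} {r s : Fin 5} {t : Bool}
    (h : ∀ k : Fin 5, σ (bif t then s - k else s + k) + r = repPerm i k) :
    CoarselyIsotopic (spans (latticeFrame (fun k => (k : ℤ)) fun k => (σ k : ℤ)))
      (spans (latticeFrame (fun k => (k : ℤ)) fun k => (repPerm i k : ℤ))) := by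
  have h1 := latticeRegular_perm 1
  have hσ := latticeRegular_perm σ
  let e : Equiv.Perm (Fin 5) := bif t then Equiv.subLeft s else Equiv.addLeft s
  have he : ∀ k, e k = bif t then s - k else s + k := by
    intro k; cases t <;> rfl
  have hc := (CoarselyIsotopic.comp_right (latticeFrame_mem h1 hσ) rfl e).symm
  have h1e : LatticeRegular fun k => (e k : ℤ) := latticeRegular_perm e
  have hσe : LatticeRegular fun k => (σ (e k) : ℤ) := latticeRegular_perm (e.trans σ)
  have hrot := isotopic_latticeFrame_add h1e hσe (-(s : ℤ)) r
  refine hc.trans (hrot.coarselyIsotopic.trans ?_)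
  have h2 : LatticeRegular fun k => (repPerm i k : ℤ) := fun k l hkl h0 => by
    have := hσe k l hkl
    dsimp only at h0 this
    rw [← h, ← h, ← he, ← he] at h0
    simp only [Fin.val_add] at h0
    omega
  have hb : ∀ k, (5 : ℤ) ∣ (repPerm i k : ℤ) - ((σ (e k) : ℤ) + r) := fun k => by
    rw [← h, ← he, Fin.val_add]
    omega
  cases t
  · refine (isotopic_of_eq (latticeFrame_mem h1 h2) rfl
      (spans_latticeFrame_congr (fun k => ?_) hb).symm).symm.coarselyIsotopic
    have := he k
    simp only [cond_false] at this
    rw [this, Fin.val_add, Equiv.Perm.one_apply]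
    omega
  · have h1n : LatticeRegular fun k => -(k : ℤ) := fun k l hkl h0 => by
      have := h1 k l hkl
      simp only [Equiv.Perm.one_apply] at this
      dsimp only at h0
      omega
    refine ⟨1, Or.inr ?_⟩
    rw [show ∀ L : Fin 5 → PLine, L ∘ (1 : Equiv.Perm (Fin 5)) = L from fun _ => rfl,
      mirrorConfig_latticeFrame]
    refine (isotopic_of_eq (latticeFrame_mem h1n h2) rfl
      (spans_latticeFrame_congr (fun k => ?_) hb).symm).symm
    have := he k
    simp only [cond_true] at this
    rw [this, Fin.val_sub]
    omega

lemma coarselyIsotopic_latticeFrame {a b a' b' : Equiv.Perm (Fin 5)}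
    (h : tripleSum (orderSign a b) ^ 2 = tripleSum (orderSign a' b') ^ 2) :
    CoarselyIsotopic (spans (latticeFrame (fun k => (a k : ℤ)) fun k => (b k : ℤ)))
      (spans (latticeFrame (fun k => (a' k : ℤ)) fun k => (b' k : ℤ))) := by
  have key : ∀ a b : Equiv.Perm (Fin 5), ∃ i : Fin 4,
      CoarselyIsotopic (spans (latticeFrame (fun k => (a k : ℤ)) fun k => (b k : ℤ)))
        (spans (latticeFrame (fun k => (k : ℤ)) fun k => (repPerm i k : ℤ))) ∧
      tripleSum (orderSign a b) ^ 2 = ![3600, 576, 144, 0] i := by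
    intro a b
    obtain ⟨i, r, s, t, h, hi⟩ := exists_repPerm (b * a⁻¹)
    refine ⟨i, ?_, ?_⟩
    · refine CoarselyIsotopic.trans ?_ (coarselyIsotopic_repPerm _ h)
      convert CoarselyIsotopic.comp_right
        (latticeFrame_mem (latticeRegular_perm 1) (latticeRegular_perm (b * a⁻¹))) rfl a using 1
      · funext k
        simp [spans, latticeFrame, polarFrame, prodFrame]
      · rfl
    · rw [← hi, ← tripleSum_comp (orderSign id (b * a⁻¹ : Equiv.Perm (Fin 5))) a]
      congr 2
      funext k l
      simp [orderSign]
  obtain ⟨i, hi, hi'⟩ := key a b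
  obtain ⟨j, hj, hj'⟩ := key a' b'
  obtain rfl : i = j := eq_of_tripleSum_sq_eq (by rw [← hi', h, hj'])
  exact hi.trans hj.symm

lemma exists_rank {θ : Fin 5 → ℝ} (hθ : Function.Injective θ) :
    ∃ a : Equiv.Perm (Fin 5), ∀ k l, θ k < θ l ↔ a k < a l := by
  have h : StrictMono (θ ∘ Tuple.sort θ) :=
    (Tuple.monotone_sort θ).strictMono_of_injective (hθ.comp (Tuple.sort θ).injective)
  refine ⟨(Tuple.sort θ)⁻¹, fun k l => ?_⟩
  rw [← h.lt_iff_lt]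
  simp

lemma sign_sub_eq_cmpSign {θ : Fin 5 → ℝ} {a : Equiv.Perm (Fin 5)}
    (ha : ∀ k l, θ k < θ l ↔ a k < a l) (k l : Fin 5) :
    SignType.sign (θ l - θ k) = cmpSign (a k) (a l) := by
  unfold cmpSign
  split_ifs with h1 h2
  · exact sign_pos (sub_pos.2 ((ha k l).2 h1))
  · exact sign_neg (sub_neg.2 ((ha l k).2 h2))
  · rw [← ha] at h1 h2
    rw [le_antisymm (not_lt.1 h1) (not_lt.1 h2), sub_self, sign_zero]

lemma exists_perm_of_bracket_ne_zero {n : Fin 5 → ℝ × ℝ}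
    (hn : ∀ k l, k ≠ l → bracket (n k) (n l) ≠ 0) :
    ∃ r : Fin 5 → ℝ, ∃ θ : Fin 5 → ℝ, ∃ a : Equiv.Perm (Fin 5), (∀ k, r k ≠ 0) ∧
      (n = fun k => r k • unitVec (θ k)) ∧
      AngleJoined θ (fun k => ((a k : ℤ) : ℝ) * (Real.pi / 5)) ∧
      ∀ k l, SignType.sign (bracket (n k) (n l)) =
        SignType.sign (r k) * SignType.sign (r l) * cmpSign (a k) (a l) := by
  have h0 : ∀ k, n k ≠ 0 := by
    intro k hk
    obtain ⟨l, hl⟩ := exists_ne k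
    exact hn k l hl.symm (by simp [hk, bracket])
  choose θ hθ r hr hnr using fun k => exists_angle (h0 k)
  have hb : ∀ k l, bracket (n k) (n l) = r k * r l * Real.sin (θ l - θ k) := by
    intro k l
    rw [hnr k, hnr l, ← bracket_unitVec]
    simp only [bracket, Prod.smul_fst, Prod.smul_snd, smul_eq_mul]
    ring
  have hinj : Function.Injective θ := by
    intro k l hkl
    by_contra hne
    exact hn k l hne (by rw [hb, hkl, sub_self, Real.sin_zero, mul_zero])
  obtain ⟨a, ha⟩ := exists_rank hinj
  have hp := Real.pi_pos
  refine ⟨r, θ, a, hr, funext hnr, angleJoined_of_lt_iff hθ (fun k => ⟨by positivity, ?_⟩) hinj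
    (fun k l => ?_), fun k l => ?_⟩
  · have : ((a k : ℤ) : ℝ) ≤ 4 := by exact_mod_cast Nat.le_of_lt_succ (a k).isLt
    nlinarith
  · rw [ha, mul_lt_mul_iff_left₀ (by positivity)]
    simp
  · rw [hb, sign_mul, sign_mul, ← sign_sub_eq_cmpSign ha, sign_sin]
    · linarith [(hθ k).2, (hθ l).1]
    · linarith [(hθ l).2, (hθ k).1]

lemma tripleSum_switch (ε : Fin 5 → Fin 5 → SignType) {s : Fin 5 → SignType}
    (hs : ∀ k, s k ≠ 0) : tripleSum (fun k l => s k * s l * ε k l) = tripleSum ε := by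
  have h1 : ∀ k, s k * s k = 1 := fun k => by
    have := hs k
    revert this
    cases s k <;> decide
  unfold tripleSum
  refine Finset.sum_congr rfl fun k _ => Finset.sum_congr rfl fun l _ =>
    Finset.sum_congr rfl fun m _ => ?_
  congr 1
  calc _ = (s k * s k) * (s l * s l) * (s m * s m) * (ε k l * ε l m * ε m k) := by
        simp only [mul_left_comm, mul_comm]
    _ = _ := by simp [h1]

/-- Products of two plane configurations are determined by the triple sum up to sign. -/
lemma coarselyIsotopic_prodFrame {n v n' v' : Fin 5 → ℝ × ℝ}
    (hn : ∀ k l, k ≠ l → bracket (n k) (n l) ≠ 0) (hv : ∀ k l, k ≠ l → bracket (v k) (v l) ≠ 0)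
    (hn' : ∀ k l, k ≠ l → bracket (n' k) (n' l) ≠ 0)
    (hv' : ∀ k l, k ≠ l → bracket (v' k) (v' l) ≠ 0)
    (h : tripleSum (fun k l => SignType.sign (bracket (n k) (n l) * bracket (v k) (v l))) ^ 2 =
      tripleSum (fun k l => SignType.sign (bracket (n' k) (n' l) * bracket (v' k) (v' l))) ^ 2) :
    CoarselyIsotopic (spans (prodFrame n v)) (spans (prodFrame n' v')) := by
  have key : ∀ n v : Fin 5 → ℝ × ℝ, (∀ k l, k ≠ l → bracket (n k) (n l) ≠ 0) →
      (∀ k l, k ≠ l → bracket (v k) (v l) ≠ 0) → ∃ a b : Equiv.Perm (Fin 5),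
      Isotopic (spans (prodFrame n v))
        (spans (latticeFrame (fun k => (a k : ℤ)) fun k => (b k : ℤ))) ∧
      tripleSum (fun k l => SignType.sign (bracket (n k) (n l) * bracket (v k) (v l))) =
        tripleSum (orderSign a b) := by
    intro n v hn hv
    obtain ⟨r, θ, a, hr, rfl, hθ, hna⟩ := exists_perm_of_bracket_ne_zero hn
    obtain ⟨s, φ, b, hs, rfl, hφ, hvb⟩ := exists_perm_of_bracket_ne_zero hv
    refine ⟨a, b, ?_, ?_⟩
    · rw [spans_prodFrame_smul _ _ hr hs]
      exact isotopic_polarFrame hθ hφ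
    · rw [← tripleSum_switch (orderSign a b) (s := fun k => SignType.sign (r k * s k))
        (fun k => sign_ne_zero.2 (mul_ne_zero (hr k) (hs k)))]
      congr 1
      funext k l
      rw [sign_mul, hna, hvb, orderSign, sign_mul, sign_mul]
      simp only [mul_assoc, mul_left_comm, mul_comm]
  obtain ⟨a, b, h1, h2⟩ := key n v hn hv
  obtain ⟨a', b', h1', h2'⟩ := key n' v' hn' hv'
  rw [h2, h2'] at h
  exact h1.coarselyIsotopic.trans
    ((coarselyIsotopic_latticeFrame h).trans h1'.symm.coarselyIsotopic)

lemma tripleSum_eq {ε : Fin 5 → Fin 5 → SignType} (h0 : ∀ k, ε k k = 0)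
    (hs : ∀ k l, ε k l = ε l k) : tripleSum ε =
      6 * ((ε 0 1 * ε 0 2 * ε 1 2 : ℤ) + ε 0 1 * ε 0 3 * ε 1 3 + ε 0 1 * ε 0 4 * ε 1 4
        + ε 0 2 * ε 0 3 * ε 2 3 + ε 0 2 * ε 0 4 * ε 2 4 + ε 0 3 * ε 0 4 * ε 3 4
        + ε 1 2 * ε 1 3 * ε 2 3 + ε 1 2 * ε 1 4 * ε 2 4 + ε 1 3 * ε 1 4 * ε 3 4
        + ε 2 3 * ε 2 4 * ε 3 4) := by
  simp only [tripleSum, Fin.sum_univ_five, SignType.coe_mul, h0, SignType.coe_zero, zero_mul,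
    mul_zero, add_zero, zero_add]
  rw [hs 1 0, hs 2 0, hs 3 0, hs 4 0, hs 2 1, hs 3 1, hs 4 1, hs 3 2, hs 4 2, hs 4 3]
  ring

/-- The sign of a boolean. -/
def boolSign (b : Bool) : ℤ := bif b then 1 else -1

lemma sq_sum_eq_of_bool (a b c d e f : Bool) : ∀ p q r s : Bool,
    let T (x y z w : ℤ) : ℤ := x * y * boolSign a + x * z * boolSign b + x * w * boolSign c
        + y * z * boolSign d + y * w * boolSign e + z * w * boolSign f
        + boolSign a * boolSign b * boolSign d + boolSign a * boolSign c * boolSign e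
        + boolSign b * boolSign c * boolSign f + boolSign d * boolSign e * boolSign f
    T (boolSign p) (boolSign q) (boolSign r) (boolSign s) ^ 2 =
      T (boolSign a * boolSign b * boolSign c * boolSign p)
        (boolSign a * boolSign d * boolSign e * boolSign q)
        (boolSign b * boolSign d * boolSign f * boolSign r)
        (boolSign c * boolSign e * boolSign f * boolSign s) ^ 2 := by
  revert a b c d e f
  decide +kernel

lemma exists_boolSign {s : SignType} (h : s ≠ 0) : ∃ b, (s : ℤ) = boolSign b := by
  revert h
  cases s
  · exact fun h => absurd rfl h
  · exact fun _ => ⟨false, rfl⟩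
  · exact fun _ => ⟨true, rfl⟩

lemma tripleSum_succAbove_sq_eq {g : Fin 6 → Fin 6 → ℝ} (h0 : ∀ k, g k k = 0)
    (hs : ∀ k l, g k l = g l k) (hne : ∀ k l, k ≠ l → g k l ≠ 0) {s : ℝ} (hs0 : s ≠ 0)
    {r : Fin 6 → ℝ} (hr : ∀ k, 2 ≤ k → r k ≠ 0)
    (h2 : s * g 2 1 = r 2 ^ 2 * (g 2 3 * g 2 4 * g 2 5) * g 2 0)
    (h3 : s * g 3 1 = r 3 ^ 2 * (g 2 3 * g 3 4 * g 3 5) * g 3 0)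
    (h4 : s * g 4 1 = r 4 ^ 2 * (g 2 4 * g 3 4 * g 4 5) * g 4 0)
    (h5 : s * g 5 1 = r 5 ^ 2 * (g 2 5 * g 3 5 * g 4 5) * g 5 0) :
    tripleSum (fun k l =>
        SignType.sign (g ((0 : Fin 6).succAbove k) ((0 : Fin 6).succAbove l))) ^ 2 =
      tripleSum (fun k l =>
        SignType.sign (g ((1 : Fin 6).succAbove k) ((1 : Fin 6).succAbove l))) ^ 2 := by
  rw [tripleSum_eq (fun k => by rw [h0, sign_zero]) (fun k l => by rw [hs]),
    tripleSum_eq (fun k => by rw [h0, sign_zero]) (fun k l => by rw [hs])]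
  have key : ∀ {u v w x y z : ℝ}, u ≠ 0 → s * x = u ^ 2 * (v * w * y) * z →
      (SignType.sign s : ℤ) * SignType.sign x = SignType.sign v * SignType.sign w *
        SignType.sign y * SignType.sign z := by
    intro u v w x y z hu h
    have := congrArg (fun x => ((SignType.sign x : SignType) : ℤ)) h
    simpa only [sign_mul, SignType.coe_mul, sign_pos (sq_pos_of_ne_zero hu), SignType.coe_one,
      one_mul] using this
  have e2 := key (hr 2 le_rfl) h2
  have e3 := key (hr 3 (by decide)) h3
  have e4 := key (hr 4 (by decide)) h4
  have e5 := key (hr 5 (by decide)) h5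
  have N : ∀ k l, k ≠ l → ∃ b, (SignType.sign (g k l) : ℤ) = boolSign b := fun k l hkl =>
    exists_boolSign (sign_ne_zero.2 (hne k l hkl))
  obtain ⟨σ, hσ⟩ := exists_boolSign (sign_ne_zero.2 hs0)
  obtain ⟨a, ha⟩ := N 2 3 (by decide)
  obtain ⟨b, hb⟩ := N 2 4 (by decide)
  obtain ⟨c, hc⟩ := N 2 5 (by decide)
  obtain ⟨d, hd⟩ := N 3 4 (by decide)
  obtain ⟨e, he⟩ := N 3 5 (by decide)
  obtain ⟨f, hf⟩ := N 4 5 (by decide)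
  obtain ⟨p, hp⟩ := N 2 0 (by decide)
  obtain ⟨q, hq⟩ := N 3 0 (by decide)
  obtain ⟨u, hu⟩ := N 4 0 (by decide)
  obtain ⟨v, hv⟩ := N 5 0 (by decide)
  rw [hσ, ha, hb, hc, hp] at e2
  rw [hσ, ha, hd, he, hq] at e3
  rw [hσ, hb, hd, hf, hu] at e4
  rw [hσ, hc, he, hf, hv] at e5
  have hσ2 : boolSign σ * boolSign σ = 1 := by cases σ <;> rfl
  have main := sq_sum_eq_of_bool a b c d e f p q u v
  dsimp only at main
  rw [← e2, ← e3, ← e4, ← e5] at main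
  simp only [Fin.succAbove, Fin.lt_def, Fin.castSucc, Fin.succ, Fin.castAdd, Fin.castLE]
  change (6 * ((SignType.sign (g 1 2) * SignType.sign (g 1 3) * SignType.sign (g 2 3) : ℤ)
      + SignType.sign (g 1 2) * SignType.sign (g 1 4) * SignType.sign (g 2 4)
      + SignType.sign (g 1 2) * SignType.sign (g 1 5) * SignType.sign (g 2 5)
      + SignType.sign (g 1 3) * SignType.sign (g 1 4) * SignType.sign (g 3 4)
      + SignType.sign (g 1 3) * SignType.sign (g 1 5) * SignType.sign (g 3 5)
      + SignType.sign (g 1 4) * SignType.sign (g 1 5) * SignType.sign (g 4 5)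
      + SignType.sign (g 2 3) * SignType.sign (g 2 4) * SignType.sign (g 3 4)
      + SignType.sign (g 2 3) * SignType.sign (g 2 5) * SignType.sign (g 3 5)
      + SignType.sign (g 2 4) * SignType.sign (g 2 5) * SignType.sign (g 4 5)
      + SignType.sign (g 3 4) * SignType.sign (g 3 5) * SignType.sign (g 4 5))) ^ 2 =
    (6 * ((SignType.sign (g 0 2) * SignType.sign (g 0 3) * SignType.sign (g 2 3) : ℤ)
      + SignType.sign (g 0 2) * SignType.sign (g 0 4) * SignType.sign (g 2 4)
      + SignType.sign (g 0 2) * SignType.sign (g 0 5) * SignType.sign (g 2 5)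
      + SignType.sign (g 0 3) * SignType.sign (g 0 4) * SignType.sign (g 3 4)
      + SignType.sign (g 0 3) * SignType.sign (g 0 5) * SignType.sign (g 3 5)
      + SignType.sign (g 0 4) * SignType.sign (g 0 5) * SignType.sign (g 4 5)
      + SignType.sign (g 2 3) * SignType.sign (g 2 4) * SignType.sign (g 3 4)
      + SignType.sign (g 2 3) * SignType.sign (g 2 5) * SignType.sign (g 3 5)
      + SignType.sign (g 2 4) * SignType.sign (g 2 5) * SignType.sign (g 4 5)
      + SignType.sign (g 3 4) * SignType.sign (g 3 5) * SignType.sign (g 4 5))) ^ 2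
  rw [hs 0 2, hs 0 3, hs 0 4, hs 0 5, hs 1 2, hs 1 3, hs 1 4, hs 1 5, ha, hb, hc, hd, he, hf, hp,
    hq, hu, hv]
  rw [mul_pow, mul_pow, main]
  congr 2
  linear_combination (-(SignType.sign (g 2 1) * SignType.sign (g 3 1) : ℤ) * boolSign a
    - SignType.sign (g 2 1) * SignType.sign (g 4 1) * boolSign b
    - SignType.sign (g 2 1) * SignType.sign (g 5 1) * boolSign c
    - SignType.sign (g 3 1) * SignType.sign (g 4 1) * boolSign d
    - SignType.sign (g 3 1) * SignType.sign (g 5 1) * boolSign e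
    - SignType.sign (g 4 1) * SignType.sign (g 5 1) * boolSign f) * hσ2

lemma tripleSum_const_mul_sq (ε : Fin 5 → Fin 5 → SignType) {τ : SignType} (hτ : τ ≠ 0) :
    tripleSum (fun k l => τ * ε k l) ^ 2 = tripleSum ε ^ 2 := by
  have h : tripleSum (fun k l => τ * ε k l) = τ * tripleSum ε := by
    simp only [tripleSum, Finset.mul_sum, SignType.coe_mul]
    refine Finset.sum_congr rfl fun k _ => Finset.sum_congr rfl fun l _ =>
      Finset.sum_congr rfl fun m _ => ?_
    have h3 : (τ : ℤ) * τ * τ = τ := by cases τ <;> simp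
    linear_combination (ε k l * ε l m * ε m k : ℤ) * h3
  have h2 : (τ : ℤ) ^ 2 = 1 := by
    revert hτ
    cases τ <;> simp
  rw [h, mul_pow, h2, one_mul]

/-- The configuration of lines joining a pair of skew lines, in coordinates. -/
lemma exists_prodFrame_of_transversal {φ : Fin 5 → V4 × V4} (hφ : φ ∈ skewFrames)
    {f : Fin 4 → V4} (hf : det2 (f 0) (f 1) (f 2) (f 3) ≠ 0)
    (h : ∀ k, det2 (φ k).1 (φ k).2 (f 0) (f 1) = 0) :
    ∃ n v : Fin 5 → ℝ × ℝ, (∀ k l, k ≠ l → bracket (n k) (n l) ≠ 0) ∧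
      (∀ k l, k ≠ l → bracket (v k) (v l) ≠ 0) ∧
      Isotopic (spans φ) (fun i => (spans (prodFrame n v) i).map (combMap f)) ∧
      tripleSum (fun k l =>
          SignType.sign (det2 (φ k).1 (φ k).2 (φ l).1 (φ l).2)) ^ 2 =
        tripleSum (fun k l => SignType.sign (bracket (n k) (n l) * bracket (v k) (v l))) ^ 2 := by
  have hpq : ∀ k, ∃ p q : V4, ∃ s t : ℝ, comb f p = (φ k).1 ∧ comb f q = (φ k).2 ∧
      s * p 2 + t * q 2 = 0 ∧ s * p 3 + t * q 3 = 0 ∧ 0 < s * s + t * t := by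
    intro k
    obtain ⟨p, hp⟩ := exists_comb_eq hf (φ k).1
    obtain ⟨q, hq⟩ := exists_comb_eq hf (φ k).2
    have e0 : f 0 = comb f ![1, 0, 0, 0] := by simp [comb]
    have e1 : f 1 = comb f ![0, 1, 0, 0] := by simp [comb]
    have h1 := h k
    rw [← hp, ← hq, e0, e1, det2_comb] at h1
    have h2 : p 2 * q 3 - p 3 * q 2 = 0 := by
      have := (mul_eq_zero.1 h1).resolve_right hf
      simp [det2_eq] at this
      linarith
    by_cases h3 : p 2 = 0 ∧ q 2 = 0
    · by_cases h4 : p 3 = 0 ∧ q 3 = 0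
      · exact ⟨p, q, 1, 0, hp, hq, by simp [h3], by simp [h4], by norm_num⟩
      · refine ⟨p, q, q 3, -p 3, hp, hq, by simp [h3], by ring, ?_⟩
        rcases not_and_or.1 h4 with h5 | h5 <;>
          nlinarith [mul_self_pos.2 h5, mul_self_nonneg (p 3), mul_self_nonneg (q 3)]
    · refine ⟨p, q, q 2, -p 2, hp, hq, by ring, by linear_combination -h2, ?_⟩
      rcases not_and_or.1 h3 with h5 | h5 <;>
        nlinarith [mul_self_pos.2 h5, mul_self_nonneg (p 2), mul_self_nonneg (q 2)]
  choose p q s t hp hq h2 h3 hst using hpq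
  set A : Fin 5 → Fin 4 → ℝ := fun k => ![s k, t k, -t k, s k] with hA
  set n : Fin 5 → ℝ × ℝ := fun k => (s k * p k 0 + t k * q k 0, s k * p k 1 + t k * q k 1)
  set w : Fin 5 → V4 := fun k => -t k • p k + s k • q k
  set v : Fin 5 → ℝ × ℝ := fun k => (w k 2, w k 3)
  set G : ℝ → Fin 5 → V4 × V4 := fun u k =>
    (![(n k).1, (n k).2, 0, 0], ![u * w k 0, u * w k 1, w k 2, w k 3]) with hG
  have dG : ∀ u k l, det2 (G u k).1 (G u k).2 (G u l).1 (G u l).2 =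
      -(bracket (n k) (n l) * bracket (v k) (v l)) := by
    intro u k l
    simp [det2_eq, hG, bracket, v]
    ring
  have hφG : changeFrame A φ = fun k => (combMap f (G 1 k).1, combMap f (G 1 k).2) := by
    funext k
    have e : ∀ a b : ℝ, a • (φ k).1 + b • (φ k).2 = comb f (a • p k + b • q k) := by
      intro a b
      rw [← combMap_apply, map_add, map_smul, map_smul, combMap_apply, combMap_apply, hp, hq]
    refine Prod.ext ?_ ?_
    · refine (e _ _).trans (congrArg (comb f) ?_)
      ext i
      fin_cases i <;> simp [hA, hG, n, h2, h3]
    · refine (e _ _).trans (congrArg (comb f) ?_)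
      ext i
      fin_cases i <;> simp [hA, hG, w]
  have hdet : ∀ k l, (s k * s k + t k * t k) * (s l * s l + t l * t l) *
      det2 (φ k).1 (φ k).2 (φ l).1 (φ l).2 =
      -(bracket (n k) (n l) * bracket (v k) (v l)) * det2 (f 0) (f 1) (f 2) (f 3) := by
    intro k l
    rw [← dG 1, ← det2_comb]
    have := det2_changeFrame A φ k l
    rw [hφG] at this
    simp only [combMap_apply] at this
    rw [this]
    simp [hA]
  have hne : ∀ k l, k ≠ l → bracket (n k) (n l) * bracket (v k) (v l) ≠ 0 := by
    intro k l hkl h0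
    have := hdet k l
    rw [h0, neg_zero, zero_mul] at this
    exact (mul_ne_zero (mul_pos (hst k) (hst l)).ne' (hφ k l hkl)) this
  refine ⟨n, v, fun k l hkl => left_ne_zero_of_mul (hne k l hkl),
    fun k l hkl => right_ne_zero_of_mul (hne k l hkl), ?_, ?_⟩
  · have hGm : ∀ u, G u ∈ skewFrames := fun u k l hkl => by
      rw [dG]; exact neg_ne_zero.2 (hne k l hkl)
    have i1 : Isotopic (spans (G 1)) (spans (prodFrame n v)) := by
      refine Isotopic.symm ⟨_, _, rfl, rfl, JoinedIn.ofLine (f := G) ?_ ?_ rfl ?_⟩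
      · refine Continuous.continuousOn (continuous_pi fun k => Continuous.prodMk ?_ ?_) <;>
        · refine continuous_pi fun i => ?_
          fin_cases i <;> simp <;> fun_prop
      · funext k
        simp [hG, prodFrame, v]
      · rintro _ ⟨u, -, rfl⟩
        exact hGm u
    have i2 := i1.map hf
    rw [map_spans, ← hφG, spans_changeFrame fun k => ?_] at i2
    · exact i2
    · simpa [hA] using (hst k).ne'
  · rw [← tripleSum_const_mul_sq _ (sign_ne_zero.2 (neg_ne_zero.2 hf))]
    congr 2
    funext k l
    have := congrArg SignType.sign (hdet k l)
    rw [sign_mul, sign_pos (mul_pos (hst k) (hst l)), one_mul] at this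
    rw [this, ← sign_mul, show -det2 (f 0) (f 1) (f 2) (f 3) *
      (-(bracket (n k) (n l) * bracket (v k) (v l)) * det2 (f 0) (f 1) (f 2) (f 3)) =
      det2 (f 0) (f 1) (f 2) (f 3) ^ 2 * (bracket (n k) (n l) * bracket (v k) (v l)) by ring,
      sign_mul, sign_pos (sq_pos_of_ne_zero hf), one_mul]

lemma map_spans_prodFrame_swap (n v : Fin 5 → ℝ × ℝ) (a b c d : V4) :
    (fun i => (spans (prodFrame n v) i).map (combMap ![a, b, c, d])) =
      fun i => (spans (prodFrame v n) i).map (combMap ![c, d, a, b]) := by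
  rw [map_spans, map_spans]
  funext i
  simp only [spans, combMap_apply, comb, prodFrame]
  rw [Set.pair_comm]
  simp [add_comm]

/-- The two configurations obtained from a double six by dropping the first or the second line are
coarse deformation equivalent. -/
lemma coarseDeformEquiv_of_transversals {L : Fin 6 → PLine} (hL : PairwiseSkew L)
    {a b c d : Fin 6 → V4} (hab : ∀ k, L k = span ℝ {a k, b k})
    (hW : ∀ k l, det2 (a k) (b k) (c l) (d l) = 0 ↔ k ≠ l) (p q : Equiv.Perm (Fin 5)) :
    CoarseDeformEquiv (L ∘ (0 : Fin 6).succAbove ∘ p) (L ∘ (1 : Fin 6).succAbove ∘ q) := by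
  set g : Fin 6 → Fin 6 → ℝ := fun k l => det2 (a k) (b k) (a l) (b l) with hg
  have hne : ∀ k l, k ≠ l → g k l ≠ 0 := by
    intro k l hkl
    obtain ⟨h1, h2, h3⟩ := hL k l hkl
    rw [hab k] at h1 h3
    rw [hab l] at h2 h3
    exact det2_ne_zero_of_inf_eq_bot h1 h2 h3
  obtain ⟨hcd, s, hs, r, hr, e2, e3, e4, e5⟩ := doubleSix_relation hW (fun _ _ => rfl) hne
  have hsum := tripleSum_succAbove_sq_eq (g := g) (fun k => by simp [hg, det2_eq]; ring)
    (fun k l => det2_swap _ _ _ _) hne hs hr e2 e3 e4 e5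
  have frame : ∀ m : Fin 6, (fun k => (a (m.succAbove k), b (m.succAbove k))) ∈ skewFrames :=
    fun m k l hkl => hne _ _ (Fin.succAbove_right_injective.ne hkl)
  have hsp : ∀ m : Fin 6, spans (fun k => (a (m.succAbove k), b (m.succAbove k))) =
      L ∘ m.succAbove := fun m => funext fun k => (hab _).symm
  obtain ⟨n, v, hn, hv, i0, t0⟩ := exists_prodFrame_of_transversal (frame 0)
    (f := ![c 0, d 0, c 1, d 1]) hcd (fun k => (hW _ _).2 (Fin.succAbove_ne _ _))
  obtain ⟨n', v', hn', hv', i1, t1⟩ := exists_prodFrame_of_transversal (frame 1)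
    (f := ![c 1, d 1, c 0, d 0]) (by rw [← det2_swap] at hcd; exact hcd)
    (fun k => (hW _ _).2 (Fin.succAbove_ne _ _))
  rw [map_spans_prodFrame_swap] at i1
  rw [hsp] at i0 i1
  refine CoarselyIsotopic.coarseDeformEquiv (coarselyIsotopic_prodFrame hn hv hv' hn' ?_)
    (f := ![c 0, d 0, c 1, d 1]) hcd i0 i1 p q
  simp only [mul_comm (bracket (v' _) _)]
  rw [← t0, ← t1]
  exact hsum

lemma coarseDeformEquiv_refl {L : Fin 5 → PLine} (hL : PairwiseSkew L) :
    CoarseDeformEquiv L L := by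
  refine Or.inl ⟨1, 1, fun _ => L, fun i => ?_, fun _ _ => hL, rfl, rfl⟩
  obtain ⟨j, hj⟩ := exists_ne i
  obtain ⟨a, b, hab⟩ := exists_eq_span_pair (hL i j hj.symm).1
  exact ⟨fun _ => a, fun _ => b, continuousOn_const, continuousOn_const, fun _ _ => hab⟩

/-- Nonsingularity, in coordinates, of the cubic form
`q₀s²t + q₁s²u + 2 q₂spt + 2 q₃spu + q₄p²t + q₅p²u + r₀st² + 2 r₁stu + r₂su² + r₃pt² + 2 r₄ptu + r₅pu²`. -/
def NonsingularCoeffs (q r : Fin 6 → ℂ) : Prop := ∀ s p t u : ℂ,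
  2 * (s * t * q 0 + s * u * q 1 + p * t * q 2 + p * u * q 3)
    + t ^ 2 * r 0 + 2 * t * u * r 1 + u ^ 2 * r 2 = 0 →
  2 * (s * t * q 2 + s * u * q 3 + p * t * q 4 + p * u * q 5)
    + t ^ 2 * r 3 + 2 * t * u * r 4 + u ^ 2 * r 5 = 0 →
  s ^ 2 * q 0 + 2 * s * p * q 2 + p ^ 2 * q 4
    + 2 * (s * t * r 0 + s * u * r 1 + p * t * r 3 + p * u * r 4) = 0 →
  s ^ 2 * q 1 + 2 * s * p * q 3 + p ^ 2 * q 5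
    + 2 * (s * t * r 1 + s * u * r 2 + p * t * r 4 + p * u * r 5) = 0 →
  s = 0 ∧ p = 0 ∧ t = 0 ∧ u = 0

/-- The cubic form vanishes on the graph of the matrix with columns `(l, 0)` and `(κ, m)`. -/
def VanishesOnGraph (q r : Fin 6 → ℂ) (l κ m : ℂ) : Prop :=
  q 0 * l + r 0 * l ^ 2 = 0 ∧
  q 0 * κ + q 1 * m + 2 * q 2 * l + 2 * r 0 * l * κ + 2 * r 1 * l * m + r 3 * l ^ 2 = 0 ∧
  2 * q 2 * κ + 2 * q 3 * m + q 4 * l + r 0 * κ ^ 2 + 2 * r 1 * κ * m + r 2 * m ^ 2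
    + 2 * r 3 * l * κ + 2 * r 4 * l * m = 0 ∧
  q 4 * κ + q 5 * m + r 3 * κ ^ 2 + 2 * r 4 * κ * m + r 5 * m ^ 2 = 0

lemma VanishesOnGraph.eq_zero {q r : Fin 6 → ℂ} {l κ m : ℂ} (h : VanishesOnGraph q r l κ m)
    (h1 : VanishesOnGraph q r 1 0 1) (hl : l ≠ 0) (hl1 : l ≠ 1) : q 0 = 0 ∧ r 0 = 0 := by
  have e1 := h.1
  have e2 := h1.1
  have h3 : l * (l - 1) * r 0 = 0 := by linear_combination e1 - l * e2
  have h4 : r 0 = 0 :=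
    (mul_eq_zero.1 h3).resolve_left (mul_ne_zero hl (sub_ne_zero.2 hl1))
  refine ⟨?_, h4⟩
  rw [h4] at e2
  linear_combination e2

lemma NonsingularCoeffs.not_double {q r : Fin 6 → ℂ} (hn : NonsingularCoeffs q r) {l κ : ℂ}
    (h : VanishesOnGraph q r l κ l) (h1 : VanishesOnGraph q r 1 0 1) (hl : l ≠ 0) (hl1 : l ≠ 1) :
    False := by
  obtain ⟨hq, hr⟩ := h.eq_zero h1 hl hl1
  have e1 := h1.2.1
  have e2 := h.2.1
  rw [hq, hr] at e1 e2
  have h3 : l * (l - 1) * (r 3 + 2 * r 1) = 0 := by linear_combination e2 - l * e1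
  have h4 := (mul_eq_zero.1 h3).resolve_left (mul_ne_zero hl (sub_ne_zero.2 hl1))
  have h5 : q 1 + 2 * q 2 = 0 := by linear_combination e1 - h4
  by_cases h0 : r 1 = 0 ∧ q 2 = 0
  · obtain ⟨hr1, hq2⟩ := h0
    have := (hn 1 0 0 0 (by simp) (by simp) (by simp [hq]) (by
      rw [hq2] at h5; linear_combination h5)).1
    exact one_ne_zero this
  · refine h0 ((hn (r 1) 0 (q 2) 0 ?_ ?_ ?_ ?_).imp id fun h => h.2.1)
    · rw [hq, hr]; ring
    · linear_combination q 2 ^ 2 * h4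
    · rw [hq, hr]; ring
    · linear_combination r 1 ^ 2 * h5

lemma NonsingularCoeffs.not_cubic_zero {q r : Fin 6 → ℂ} (hn : NonsingularCoeffs q r)
    (h0 : q 0 = 0) (h1 : q 1 + 2 * q 2 = 0) (h2 : 2 * q 3 + q 4 = 0) (h3 : q 5 = 0) : False := by
  by_cases h : q 4 = 0 ∧ q 2 = 0
  · have := (hn 1 0 0 0 (by simp) (by simp) (by simp [h0]) (by
      rw [h.2] at h1; linear_combination h1)).1
    exact one_ne_zero this
  · refine h ((hn (q 4) (-2 * q 2) 0 0 ?_ ?_ ?_ ?_).imp id fun h => ?_)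
    · simp
    · simp
    · rw [h0]; ring
    · rw [h3]; linear_combination q 4 ^ 2 * h1 - 2 * q 2 * q 4 * h2
    · have := h.1
      linear_combination (-1 / 2) * this

lemma leading_coeff_eq_zero {a b c d x y z w : ℂ}
    (hx : a + b * x + c * x ^ 2 + d * x ^ 3 = 0) (hy : a + b * y + c * y ^ 2 + d * y ^ 3 = 0)
    (hz : a + b * z + c * z ^ 2 + d * z ^ 3 = 0) (hw : a + b * w + c * w ^ 2 + d * w ^ 3 = 0)
    (hxy : x ≠ y) (hxz : x ≠ z) (hxw : x ≠ w) (hyz : y ≠ z) (hyw : y ≠ w) (hzw : z ≠ w) :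
    d = 0 := by
  have quad : ∀ {t}, t ≠ x → a + b * t + c * t ^ 2 + d * t ^ 3 = 0 →
      b + c * (t + x) + d * (t ^ 2 + t * x + x ^ 2) = 0 := by
    intro t ht h
    apply mul_left_cancel₀ (sub_ne_zero.2 ht)
    linear_combination h - hx
  have ey := quad hxy.symm hy
  have ez := quad hxz.symm hz
  have ew := quad hxw.symm hw
  have hz2 : c + d * (x + y + z) = 0 := by
    apply mul_left_cancel₀ (sub_ne_zero.2 hyz)
    linear_combination ey - ez
  have hw2 : c + d * (x + y + w) = 0 := by
    apply mul_left_cancel₀ (sub_ne_zero.2 hyw)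
    linear_combination ey - ew
  apply mul_left_cancel₀ (sub_ne_zero.2 hzw)
  linear_combination hz2 - hw2

/-- A line on the cubic surface makes the residual conic of a plane through `t = u = 0`
singular. -/
lemma VanishesOnGraph.conic_det {q r : Fin 6 → ℂ} {l κ m : ℂ} (h : VanishesOnGraph q r l κ m)
    (hq : q 0 = 0) (hr : r 0 = 0) (hm : m ≠ 0) :
    (-q 1 * q 4 ^ 2 / 4 - q 2 ^ 2 * q 5 + q 2 * q 3 * q 4)
      + (q 1 * r 3 * q 5 - q 1 * q 4 * r 4 - 2 * r 1 * q 2 * q 5 - q 2 ^ 2 * r 5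
          + r 1 * q 3 * q 4 + q 2 * r 2 * q 4 / 2 + 2 * q 2 * q 3 * r 4 - r 3 * q 3 ^ 2) * m
      + (q 1 * r 3 * r 5 - q 1 * r 4 ^ 2 - r 1 ^ 2 * q 5 - 2 * r 1 * q 2 * r 5
          + 2 * r 1 * q 3 * r 4 + r 1 * r 2 * q 4 / 2 + q 2 * r 2 * r 4 - r 3 * q 3 * r 2) * m ^ 2
      + (-r 1 ^ 2 * r 5 + r 1 * r 4 * r 2 - r 3 * r 2 ^ 2 / 4) * m ^ 3 = 0 := by
  obtain ⟨-, h1, h2, h3⟩ := h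
  rw [hq, hr] at h1
  rw [hr] at h2
  apply mul_left_cancel₀ hm
  have i1 : q 1 * m + 2 * l * (r 1 * m + q 2) + l ^ 2 * r 3 = 0 := by linear_combination h1
  have i2 : κ * (r 1 * m + q 2) + l * κ * r 3 + (q 3 * m + r 2 * m ^ 2 / 2)
      + l * (q 4 / 2 + r 4 * m) = 0 := by linear_combination h2 / 2
  have i3 : κ ^ 2 * r 3 + 2 * κ * (q 4 / 2 + r 4 * m) + (q 5 * m + r 5 * m ^ 2) = 0 := by
    linear_combination h3
  linear_combination
    i1 * ((κ ^ 2 * r 3 + 2 * κ * (q 4 / 2 + r 4 * m) + (q 5 * m + r 5 * m ^ 2)) * r 3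
        - (q 4 / 2 + r 4 * m + κ * r 3) ^ 2)
      - i2 * ((κ * (r 1 * m + q 2) + l * κ * r 3 + (q 3 * m + r 2 * m ^ 2 / 2)
          + l * (q 4 / 2 + r 4 * m)) * r 3
        - 2 * (r 1 * m + q 2 + l * r 3) * (q 4 / 2 + r 4 * m + κ * r 3))
      - i3 * (r 1 * m + q 2 + l * r 3) ^ 2

lemma NonsingularCoeffs.leading_ne_zero {q r : Fin 6 → ℂ} (hn : NonsingularCoeffs q r)
    (hr : r 0 = 0) : -r 1 ^ 2 * r 5 + r 1 * r 4 * r 2 - r 3 * r 2 ^ 2 / 4 ≠ 0 := by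
  intro h
  by_cases h1 : r 1 = 0
  · by_cases h3 : r 3 = 0
    · have := (hn 0 0 1 0 (by simp [hr]) (by simp [h3]) (by simp) (by simp)).2.2.1
      exact one_ne_zero this
    · have h2 : r 2 = 0 := by
        rw [h1] at h
        have : r 3 * r 2 ^ 2 = 0 := by linear_combination -4 * h
        simpa [h3] using this
      obtain ⟨d, hd⟩ := IsAlgClosed.exists_pow_nat_eq (r 4 ^ 2 - r 3 * r 5) two_pos
      have := (hn 0 0 ((-r 4 + d) / r 3) 1 (by simp [hr, h1, h2]) (by
        field_simp
        linear_combination hd) (by simp) (by simp)).2.2.2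
      exact one_ne_zero this
  · refine h1 (hn 0 0 (-r 2 / 2) (r 1) ?_ ?_ ?_ ?_).2.2.2
    · rw [hr]; ring
    · linear_combination -h
    · simp
    · simp

lemma NonsingularCoeffs.not_common {q r : Fin 6 → ℂ} (hn : NonsingularCoeffs q r)
    {l l' l'' κ κ' κ'' m m' m'' : ℂ} (h1 : VanishesOnGraph q r 1 0 1)
    (h : VanishesOnGraph q r l κ m) (h' : VanishesOnGraph q r l' κ' m')
    (h'' : VanishesOnGraph q r l'' κ'' m'') (hl : l ≠ 0) (hl1 : l ≠ 1)
    (hm : m ≠ 0) (hm' : m' ≠ 0) (hm'' : m'' ≠ 0) (hm1 : m ≠ 1) (hm1' : m' ≠ 1) (hm1'' : m'' ≠ 1)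
    (hmm' : m ≠ m') (hmm'' : m ≠ m'') (hmm : m' ≠ m'') : False := by
  obtain ⟨hq, hr⟩ := h.eq_zero h1 hl hl1
  exact hn.leading_ne_zero hr (leading_coeff_eq_zero (h1.conic_det hq hr one_ne_zero)
    (h.conic_det hq hr hm) (h'.conic_det hq hr hm') (h''.conic_det hq hr hm'')
    hm1.symm hm1'.symm hm1''.symm hmm' hmm'' hmm)

/-- The determinant of two complex plane vectors. -/
def cross (z e : Fin 2 → ℂ) : ℂ := z 0 * e 1 - z 1 * e 0

lemma exists_cross_ne_zero {z : Fin 2 → ℂ} (hz : z ≠ 0) : ∃ e, cross z e ≠ 0 := by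
  by_cases h : z 0 = 0
  · refine ⟨![1, 0], fun h1 => hz ?_⟩
    ext i
    fin_cases i
    · exact h
    · simpa [cross] using h1
  · exact ⟨![0, 1], by simpa [cross] using h⟩

lemma exists_eq_smul_add_smul {z e : Fin 2 → ℂ} (h : cross z e ≠ 0) (x : Fin 2 → ℂ) :
    ∃ s p : ℂ, x = s • z + p • e := by
  refine ⟨cross x e / cross z e, cross z x / cross z e, ?_⟩
  ext i
  simp only [Pi.add_apply, Pi.smul_apply, smul_eq_mul]
  field_simp
  fin_cases i <;> simp [cross] <;> ring

lemma eq_zero_of_smul_add_smul {z e : Fin 2 → ℂ} (h : cross z e ≠ 0) {s p : ℂ}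
    (h0 : s • z + p • e = 0) : s = 0 ∧ p = 0 := by
  have e0 : s * z 0 + p * e 0 = 0 := by simpa using congrFun h0 0
  have e1 : s * z 1 + p * e 1 = 0 := by simpa using congrFun h0 1
  constructor
  · refine (mul_eq_zero.1 (?_ : s * cross z e = 0)).resolve_right h
    rw [cross]
    linear_combination e 1 * e0 - e 0 * e1
  · refine (mul_eq_zero.1 (?_ : p * cross z e = 0)).resolve_right h
    rw [cross]
    linear_combination z 0 * e1 - z 1 * e0

open Matrix in
lemma cross_mulVec (M : Matrix (Fin 2) (Fin 2) ℂ) (z e : Fin 2 → ℂ) :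
    cross (M *ᵥ z) (M *ᵥ e) = M.det * cross z e := by
  simp only [cross, mulVec, dotProduct, Fin.sum_univ_two, det_fin_two]
  ring

open Matrix in
lemma cross_mulVec_add_cross_mulVec (M : Matrix (Fin 2) (Fin 2) ℂ) (z e : Fin 2 → ℂ) :
    cross (M *ᵥ z) e + cross z (M *ᵥ e) = (M 0 0 + M 1 1) * cross z e := by
  simp only [cross, mulVec, dotProduct, Fin.sum_univ_two]
  ring

/-- The quadratic form whose zeros are the eigenvectors of a matrix. -/
def eigenForm {K : Type*} [CommRing K] (M : Matrix (Fin 2) (Fin 2) K) (x : Fin 2 → K) : K :=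
  M 1 0 * x 0 ^ 2 + (M 1 1 - M 0 0) * x 0 * x 1 - M 0 1 * x 1 ^ 2

open Matrix in
lemma exists_mulVec_eq_smul {M : Matrix (Fin 2) (Fin 2) ℂ} {z : Fin 2 → ℂ} (hz : z ≠ 0)
    (h : eigenForm M z = 0) : ∃ l : ℂ, M *ᵥ z = l • z := by
  obtain ⟨e, he⟩ := exists_cross_ne_zero hz
  obtain ⟨s, p, hsp⟩ := exists_eq_smul_add_smul he (M *ᵥ z)
  have h1 : cross z (M *ᵥ z) = p * cross z e := by
    rw [hsp]; simp [cross]; ring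
  have h2 : cross z (M *ᵥ z) = eigenForm M z := by
    simp only [cross, mulVec, dotProduct, Fin.sum_univ_two, eigenForm]
    ring
  rw [h2, h] at h1
  have : p = 0 := (mul_eq_zero.1 h1.symm).resolve_right he
  exact ⟨s, by rw [hsp, this, zero_smul, add_zero]⟩

open Matrix in
lemma exists_mulVec_eq_of_eigenvector {M : Matrix (Fin 2) (Fin 2) ℂ} {z e : Fin 2 → ℂ} {l : ℂ}
    (h : M *ᵥ z = l • z) (he : cross z e ≠ 0) :
    ∃ κ m : ℂ, M *ᵥ e = κ • z + m • e ∧ M 0 0 + M 1 1 = l + m := by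
  obtain ⟨κ, m, hm⟩ := exists_eq_smul_add_smul he (M *ᵥ e)
  refine ⟨κ, m, hm, mul_right_cancel₀ he ?_⟩
  rw [← cross_mulVec_add_cross_mulVec, h, hm]
  simp [cross]
  ring

open Matrix in
lemma det_eq_of_eigenvector {M : Matrix (Fin 2) (Fin 2) ℂ} {z e : Fin 2 → ℂ} {l κ m : ℂ}
    (he : cross z e ≠ 0) (h : M *ᵥ z = l • z) (h' : M *ᵥ e = κ • z + m • e) : M.det = l * m := by
  apply mul_right_cancel₀ he
  rw [← cross_mulVec, h, h']
  simp [cross]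
  ring

open Matrix in
lemma det_sub_eq_of_eigenvector {M N : Matrix (Fin 2) (Fin 2) ℂ} {z e : Fin 2 → ℂ}
    {l κ m l' κ' m' : ℂ} (he : cross z e ≠ 0) (h : M *ᵥ z = l • z) (h' : M *ᵥ e = κ • z + m • e)
    (hN : N *ᵥ z = l' • z) (hN' : N *ᵥ e = κ' • z + m' • e) :
    (M - N).det = (l - l') * (m - m') := by
  refine det_eq_of_eigenvector he (κ := κ - κ') ?_ ?_
  · rw [sub_mulVec, h, hN, sub_smul]
  · rw [sub_mulVec, h', hN']
    module

/-- A binary quadratic form with nonzero discriminant has two independent zeros. -/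
lemma exists_zeros_of_discr_ne_zero {a b c : ℂ} (h : b ^ 2 - 4 * a * c ≠ 0) :
    ∃ z w : Fin 2 → ℂ, cross z w ≠ 0 ∧ a * z 0 ^ 2 + b * z 0 * z 1 + c * z 1 ^ 2 = 0 ∧
      a * w 0 ^ 2 + b * w 0 * w 1 + c * w 1 ^ 2 = 0 := by
  by_cases ha : a = 0
  · have hb : b ≠ 0 := by rintro rfl; simp [ha] at h
    exact ⟨![1, 0], ![c, -b], by simpa [cross] using hb, by simp [ha], by simp [ha]; ring⟩
  · obtain ⟨d, hd⟩ := IsAlgClosed.exists_pow_nat_eq (b ^ 2 - 4 * a * c) two_pos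
    have hd0 : d ≠ 0 := by rintro rfl; exact h (by rw [← hd]; ring)
    refine ⟨![-b + d, 2 * a], ![-b - d, 2 * a], ?_, ?_, ?_⟩
    · have : cross ![-b + d, 2 * a] ![-b - d, 2 * a] = 4 * a * d := by simp [cross]; ring
      rw [this]
      exact mul_ne_zero (mul_ne_zero (by norm_num) ha) hd0
    · simp
      linear_combination a * hd
    · simp
      linear_combination a * hd

section CubicPair

open Matrix

variable (Q R : (Fin 2 → ℂ) →ₗ[ℂ] (Fin 2 → ℂ) →ₗ[ℂ] (Fin 2 → ℂ) →ₗ[ℂ] ℂ)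

/-- The cubic form `Q(x, x, y) + R(x, y, y)` is nonsingular, where `Q` is symmetric in the first
two variables and `R` in the last two. -/
structure NonsingularCubic : Prop where
  symm_left : ∀ x u y, Q x u y = Q u x y
  symm_right : ∀ x y v, R x y v = R x v y
  nonsingular : ∀ x y, (∀ u, 2 * Q x u y + R u y y = 0) → (∀ v, Q x x v + 2 * R x y v = 0) →
    x = 0 ∧ y = 0

/-- The cubic form vanishes on the graph of a matrix. -/
def VanishesOn (M : Matrix (Fin 2) (Fin 2) ℂ) : Prop :=
  ∀ x, Q x x (M *ᵥ x) + R x (M *ᵥ x) (M *ᵥ x) = 0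

variable {Q R}

lemma NonsingularCubic.coeffs (h : NonsingularCubic Q R) {z e : Fin 2 → ℂ}
    (he : cross z e ≠ 0) :
    NonsingularCoeffs ![Q z z z, Q z z e, Q z e z, Q z e e, Q e e z, Q e e e]
      ![R z z z, R z z e, R z e e, R e z z, R e z e, R e e e] := by
  intro s p t u h1 h2 h3 h4
  simp at h1 h2 h3 h4
  have hxy := h.nonsingular (s • z + p • e) (t • z + u • e) (fun w => by
    obtain ⟨a, b, rfl⟩ := exists_eq_smul_add_smul he w
    simp only [map_add, map_smul, LinearMap.add_apply, LinearMap.smul_apply, smul_eq_mul,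
      h.symm_left e z, h.symm_right _ e z]
    linear_combination a * h1 + b * h2) (fun w => by
    obtain ⟨a, b, rfl⟩ := exists_eq_smul_add_smul he w
    simp only [map_add, map_smul, LinearMap.add_apply, LinearMap.smul_apply, smul_eq_mul,
      h.symm_left e z, h.symm_right _ e z]
    linear_combination a * h3 + b * h4)
  obtain ⟨hs, hp⟩ := eq_zero_of_smul_add_smul he hxy.1
  obtain ⟨ht, hu⟩ := eq_zero_of_smul_add_smul he hxy.2
  exact ⟨hs, hp, ht, hu⟩

lemma VanishesOn.coeffs (h : NonsingularCubic Q R) {M : Matrix (Fin 2) (Fin 2) ℂ}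
    (hM : VanishesOn Q R M) {z e : Fin 2 → ℂ} {l κ m : ℂ} (hz : M *ᵥ z = l • z)
    (he : M *ᵥ e = κ • z + m • e) :
    VanishesOnGraph ![Q z z z, Q z z e, Q z e z, Q z e e, Q e e z, Q e e e]
      ![R z z z, R z z e, R z e e, R e z z, R e z e, R e e e] l κ m := by
  have key : ∀ s p : ℂ, _ := fun s p => hM (s • z + p • e)
  simp only [mulVec_add, mulVec_smul, hz, he, map_add, map_smul, LinearMap.add_apply,
    LinearMap.smul_apply, smul_eq_mul, h.symm_left e z, h.symm_right _ e z] at key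
  have k1 := key 1 0
  have k2 := key 0 1
  have k3 := key 1 1
  have k4 := key 1 (-1)
  unfold VanishesOnGraph
  simp
  refine ⟨?_, ?_, ?_, ?_⟩
  · linear_combination k1
  · linear_combination k3 / 2 - k4 / 2 - k2
  · linear_combination k3 / 2 + k4 / 2 - k1
  · linear_combination k2

lemma VanishesOn.coeffs_one (h : NonsingularCubic Q R) (h1 : VanishesOn Q R 1)
    (z e : Fin 2 → ℂ) :
    VanishesOnGraph ![Q z z z, Q z z e, Q z e z, Q z e e, Q e e z, Q e e e]
      ![R z z z, R z z e, R z e e, R e z z, R e z e, R e e e] 1 0 1 :=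
  h1.coeffs h (by simp) (by simp)

/-- A matrix none of whose eigenvalues is `0` or `1`, in terms of determinants, on whose graph
the cubic form vanishes. -/
structure IsGraphLine (Q R : (Fin 2 → ℂ) →ₗ[ℂ] (Fin 2 → ℂ) →ₗ[ℂ] (Fin 2 → ℂ) →ₗ[ℂ] ℂ)
    (M : Matrix (Fin 2) (Fin 2) ℂ) : Prop where
  vanishes : VanishesOn Q R M
  det_ne_zero : M.det ≠ 0
  det_sub_one_ne_zero : (M - 1).det ≠ 0

lemma IsGraphLine.ne {A : Matrix (Fin 2) (Fin 2) ℂ} (hA : IsGraphLine Q R A) {z e : Fin 2 → ℂ}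
    {l κ m : ℂ} (he : cross z e ≠ 0) (h : A *ᵥ z = l • z) (h' : A *ᵥ e = κ • z + m • e) :
    l ≠ 0 ∧ l ≠ 1 ∧ m ≠ 0 ∧ m ≠ 1 := by
  have h1 := hA.det_ne_zero
  have h2 := hA.det_sub_one_ne_zero
  rw [det_eq_of_eigenvector he h h'] at h1
  rw [det_sub_eq_of_eigenvector he h h' (l' := 1) (κ' := 0) (m' := 1) (by simp) (by simp)] at h2
  exact ⟨left_ne_zero_of_mul h1, sub_ne_zero.1 (left_ne_zero_of_mul h2),
    right_ne_zero_of_mul h1, sub_ne_zero.1 (right_ne_zero_of_mul h2)⟩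

lemma IsGraphLine.apply_self_eq_zero (h : NonsingularCubic Q R) (h1 : VanishesOn Q R 1)
    {A : Matrix (Fin 2) (Fin 2) ℂ} (hA : IsGraphLine Q R A) {z : Fin 2 → ℂ} (hz : z ≠ 0)
    (hAz : eigenForm A z = 0) : Q z z z = 0 := by
  obtain ⟨e, he⟩ := exists_cross_ne_zero hz
  obtain ⟨l, hl⟩ := exists_mulVec_eq_smul hz hAz
  obtain ⟨κ, m, hm, -⟩ := exists_mulVec_eq_of_eigenvector hl he
  obtain ⟨l0, l1, -, -⟩ := hA.ne he hl hm
  exact ((hA.vanishes.coeffs h hl hm).eq_zero (h1.coeffs_one h z e) l0 l1).1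

lemma IsGraphLine.discr_ne_zero (h : NonsingularCubic Q R) (h1 : VanishesOn Q R 1)
    {A : Matrix (Fin 2) (Fin 2) ℂ} (hA : IsGraphLine Q R A) :
    (A 1 1 - A 0 0) ^ 2 - 4 * A 1 0 * (-A 0 1) ≠ 0 := by
  intro hd
  have : ∃ z, z ≠ 0 ∧ eigenForm A z = 0 := by
    by_cases h0 : A 1 0 = 0
    · refine ⟨![1, 0], fun h => by simpa using congrFun h 0, by simp [eigenForm, h0]⟩
    · refine ⟨![-(A 1 1 - A 0 0), 2 * A 1 0], fun h => h0 (by simpa using congrFun h 1), ?_⟩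
      simp [eigenForm]
      linear_combination -A 1 0 * hd
  obtain ⟨z, hz, hAz⟩ := this
  obtain ⟨e, he⟩ := exists_cross_ne_zero hz
  obtain ⟨l, hl⟩ := exists_mulVec_eq_smul hz hAz
  obtain ⟨κ, m, hm, htr⟩ := exists_mulVec_eq_of_eigenvector hl he
  obtain ⟨l0, l1, -, -⟩ := hA.ne he hl hm
  have hdet := det_eq_of_eigenvector he hl hm
  rw [det_fin_two] at hdet
  have hlm : (l - m) ^ 2 = 0 := by
    linear_combination hd + 4 * hdet - (A 0 0 + A 1 1 + l + m) * htr
  obtain rfl : l = m := sub_eq_zero.1 (pow_eq_zero_iff two_ne_zero |>.1 hlm)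
  exact (h.coeffs he).not_double (hA.vanishes.coeffs h hl hm) (h1.coeffs_one h z e) l0 l1

lemma IsGraphLine.exists_common_zero (h : NonsingularCubic Q R) (h1 : VanishesOn Q R 1)
    {A B : Matrix (Fin 2) (Fin 2) ℂ} (hA : IsGraphLine Q R A) (hB : IsGraphLine Q R B) :
    ∃ z, z ≠ 0 ∧ eigenForm A z = 0 ∧ eigenForm B z = 0 := by
  have zeros : ∀ {M : Matrix (Fin 2) (Fin 2) ℂ}, IsGraphLine Q R M →
      ∃ z w, cross z w ≠ 0 ∧ eigenForm M z = 0 ∧ eigenForm M w = 0 := by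
    intro M hM
    obtain ⟨z, w, hzw, hz, hw⟩ := exists_zeros_of_discr_ne_zero (hM.discr_ne_zero h h1)
    exact ⟨z, w, hzw, by rw [eigenForm]; linear_combination hz,
      by rw [eigenForm]; linear_combination hw⟩
  have ne_left : ∀ {z w : Fin 2 → ℂ}, cross z w ≠ 0 → z ≠ 0 := by
    rintro z w h rfl; simp [cross] at h
  have ne_right : ∀ {z w : Fin 2 → ℂ}, cross z w ≠ 0 → w ≠ 0 := by
    rintro z w h rfl; simp [cross] at h
  obtain ⟨z, w, hzw, hz, hw⟩ := zeros hA
  obtain ⟨x, y, hxy, hx, hy⟩ := zeros hB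
  by_contra! hno
  have hBz := hno z (ne_left hzw) hz
  have hBw := hno w (ne_right hzw) hw
  have smul : ∀ (c : ℂ) (v : Fin 2 → ℂ), eigenForm B (c • v) = c ^ 2 * eigenForm B v := by
    intro c v; simp [eigenForm]; ring
  have comb : ∀ {v}, v ≠ 0 → eigenForm B v = 0 →
      ∃ s p : ℂ, v = s • z + p • w ∧ s ≠ 0 ∧ p ≠ 0 ∧
        s * (Q z z w + 2 * Q z w z) + p * (2 * Q z w w + Q w w z) = 0 := by
    intro v hv hBv
    obtain ⟨s, p, rfl⟩ := exists_eq_smul_add_smul hzw v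
    have hs : s ≠ 0 := by
      rintro rfl
      rw [zero_smul, zero_add] at hv hBv
      rw [smul] at hBv
      have hp : p ≠ 0 := by rintro rfl; simp at hv
      exact mul_ne_zero (pow_ne_zero 2 hp) hBw hBv
    have hp : p ≠ 0 := by
      rintro rfl
      rw [zero_smul, add_zero, smul] at hBv
      exact mul_ne_zero (pow_ne_zero 2 hs) hBz hBv
    refine ⟨s, p, rfl, hs, hp, ?_⟩
    have h0 := hB.apply_self_eq_zero h h1 hv hBv
    have hQz := hA.apply_self_eq_zero h h1 (ne_left hzw) hz
    have hQw := hA.apply_self_eq_zero h h1 (ne_right hzw) hw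
    simp only [map_add, map_smul, LinearMap.add_apply, LinearMap.smul_apply, smul_eq_mul,
      h.symm_left w z, hQz, hQw] at h0
    apply mul_left_cancel₀ (mul_ne_zero hs hp)
    linear_combination h0
  obtain ⟨s, p, rfl, hs, hp, e1⟩ := comb (ne_left hxy) hx
  obtain ⟨s', p', rfl, hs', hp', e2⟩ := comb (ne_right hxy) hy
  have hd : s * p' - p * s' ≠ 0 := by
    intro h0
    apply hxy
    have : cross (s • z + p • w) (s' • z + p' • w) = (s * p' - p * s') * cross z w := by
      simp [cross]; ring
    rw [this, h0, zero_mul]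
  refine (h.coeffs hzw).not_cubic_zero ?_ ?_ ?_ ?_
  · exact hA.apply_self_eq_zero h h1 (ne_left hzw) hz
  · apply mul_left_cancel₀ hd
    simp only [Matrix.cons_val]
    linear_combination p' * e1 - p * e2
  · apply mul_left_cancel₀ hd
    simp only [Matrix.cons_val]
    linear_combination s * e2 - s' * e1
  · exact hA.apply_self_eq_zero h h1 (ne_right hzw) hw

lemma IsGraphLine.not_common_zero (h : NonsingularCubic Q R) (h1 : VanishesOn Q R 1)
    {A B C : Matrix (Fin 2) (Fin 2) ℂ} (hA : IsGraphLine Q R A) (hB : IsGraphLine Q R B)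
    (hC : IsGraphLine Q R C) (hAB : (A - B).det ≠ 0) (hAC : (A - C).det ≠ 0)
    (hBC : (B - C).det ≠ 0) {z : Fin 2 → ℂ} (hz : z ≠ 0) (zA : eigenForm A z = 0)
    (zB : eigenForm B z = 0) : eigenForm C z ≠ 0 := by
  intro zC
  obtain ⟨e, he⟩ := exists_cross_ne_zero hz
  obtain ⟨l, hl⟩ := exists_mulVec_eq_smul hz zA
  obtain ⟨κ, m, hm, -⟩ := exists_mulVec_eq_of_eigenvector hl he
  obtain ⟨l', hl'⟩ := exists_mulVec_eq_smul hz zB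
  obtain ⟨κ', m', hm', -⟩ := exists_mulVec_eq_of_eigenvector hl' he
  obtain ⟨l'', hl''⟩ := exists_mulVec_eq_smul hz zC
  obtain ⟨κ'', m'', hm'', -⟩ := exists_mulVec_eq_of_eigenvector hl'' he
  rw [det_sub_eq_of_eigenvector he hl hm hl' hm'] at hAB
  rw [det_sub_eq_of_eigenvector he hl hm hl'' hm''] at hAC
  rw [det_sub_eq_of_eigenvector he hl' hm' hl'' hm''] at hBC
  obtain ⟨n0, n1, n2, n3⟩ := hA.ne he hl hm
  obtain ⟨-, -, n2', n3'⟩ := hB.ne he hl' hm'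
  obtain ⟨-, -, n2'', n3''⟩ := hC.ne he hl'' hm''
  exact (h.coeffs he).not_common (h1.coeffs_one h z e) (hA.vanishes.coeffs h hl hm)
    (hB.vanishes.coeffs h hl' hm') (hC.vanishes.coeffs h hl'' hm'') n0 n1 n2 n2' n2'' n3 n3' n3''
    (sub_ne_zero.1 (right_ne_zero_of_mul hAB)) (sub_ne_zero.1 (right_ne_zero_of_mul hAC))
    (sub_ne_zero.1 (right_ne_zero_of_mul hBC))

lemma eigenForm_map_ofReal (M : Matrix (Fin 2) (Fin 2) ℝ) (x : Fin 2 → ℝ) :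
    eigenForm (M.map Complex.ofReal) (fun i => (x i : ℂ)) = (eigenForm M x : ℝ) := by
  simp [eigenForm]

/-- Two of the residual quadratic forms have a common real zero at which the third is nonzero. -/
theorem exists_real_common_zero (h : NonsingularCubic Q R) (h1 : VanishesOn Q R 1)
    {A B C : Matrix (Fin 2) (Fin 2) ℝ} (hA : IsGraphLine Q R (A.map Complex.ofReal))
    (hB : IsGraphLine Q R (B.map Complex.ofReal)) (hC : IsGraphLine Q R (C.map Complex.ofReal))
    (hAB : (A - B).det ≠ 0) (hAC : (A - C).det ≠ 0) (hBC : (B - C).det ≠ 0) :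
    ∃ x : Fin 2 → ℝ, eigenForm A x = 0 ∧ eigenForm B x = 0 ∧ eigenForm C x ≠ 0 := by
  have hdet : ∀ {M N : Matrix (Fin 2) (Fin 2) ℝ}, (M - N).det ≠ 0 →
      (M.map Complex.ofReal - N.map Complex.ofReal).det ≠ 0 := by
    intro M N hMN h0
    apply hMN
    rw [det_fin_two] at h0 ⊢
    simp only [Matrix.sub_apply, map_apply] at h0 ⊢
    exact_mod_cast h0
  have hno := fun {z} => IsGraphLine.not_common_zero h h1 hA hB hC (hdet hAB) (hdet hAC) (hdet hBC)
    (z := z)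
  obtain ⟨z, hz, zA, zB⟩ := hA.exists_common_zero h h1 hB
  set r0 := (A 1 1 - A 0 0) * (-B 0 1) - (-A 0 1) * (B 1 1 - B 0 0) with hr0
  set r1 := (-A 0 1) * B 1 0 - A 1 0 * (-B 0 1) with hr1
  set r2 := A 1 0 * (B 1 1 - B 0 0) - (A 1 1 - A 0 0) * B 1 0 with hr2
  have fin : ∀ x : Fin 2 → ℝ, x ≠ 0 → eigenForm A x = 0 → eigenForm B x = 0 →
      ∃ x : Fin 2 → ℝ, eigenForm A x = 0 ∧ eigenForm B x = 0 ∧ eigenForm C x ≠ 0 := by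
    intro x hx xA xB
    refine ⟨x, xA, xB, fun xC => ?_⟩
    refine hno (z := fun i => (x i : ℂ)) (fun h0 => hx ?_) ?_ ?_ ?_
    · ext i
      simpa using congrFun h0 i
    · rw [eigenForm_map_ofReal, xA, Complex.ofReal_zero]
    · rw [eigenForm_map_ofReal, xB, Complex.ofReal_zero]
    · rw [eigenForm_map_ofReal, xC, Complex.ofReal_zero]
  have vA : (A 1 0 : ℂ) * z 0 ^ 2 + (A 1 1 - A 0 0) * z 0 * z 1 - A 0 1 * z 1 ^ 2 = 0 := zA
  have vB : (B 1 0 : ℂ) * z 0 ^ 2 + (B 1 1 - B 0 0) * z 0 * z 1 - B 0 1 * z 1 ^ 2 = 0 := zB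
  have k01 : z 0 ^ 2 * r1 = z 0 * z 1 * r0 := by
    simp only [hr0, hr1]; push_cast
    linear_combination (-A 0 1 : ℂ) * vB + (B 0 1 : ℂ) * vA
  have k02 : z 0 ^ 2 * r2 = z 1 ^ 2 * r0 := by
    simp only [hr0, hr2]; push_cast
    linear_combination ((A 0 0 : ℂ) - A 1 1) * vB + ((B 1 1 : ℂ) - B 0 0) * vA
  have k12 : z 0 * z 1 * r2 = z 1 ^ 2 * r1 := by
    simp only [hr1, hr2]; push_cast
    linear_combination (A 1 0 : ℂ) * vB - (B 1 0 : ℂ) * vA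
  have hr : r1 ^ 2 = r0 * r2 := by
    by_cases hz0 : z 0 = 0
    · have hz1 : z 1 ≠ 0 := fun hz1 => hz (by ext i; fin_cases i <;> assumption)
      have e0 : r0 = 0 := by simpa [hz0, hz1] using k02
      have e1 : r1 = 0 := by simpa [hz0, hz1] using k12
      rw [e0, e1]; ring
    · have : ((r1 : ℂ) ^ 2 = r0 * r2) := by
        apply mul_left_cancel₀ (pow_ne_zero 4 hz0)
        linear_combination (z 0 ^ 2 * r1 + z 0 * z 1 * r0) * k01 - z 0 ^ 2 * r0 * k02
      exact_mod_cast this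
  by_cases h0 : r0 = 0
  · have h10 : r1 = 0 := by simpa [h0] using hr
    by_cases h2 : r2 = 0
    · exfalso
      obtain ⟨w, hw, wA, wC⟩ := hA.exists_common_zero h h1 hC
      refine hno hw wA ?_ wC
      have vA : (A 1 0 : ℂ) * w 0 ^ 2 + (A 1 1 - A 0 0) * w 0 * w 1 - A 0 1 * w 1 ^ 2 = 0 := wA
      have c0 := congrArg Complex.ofReal (hr0.symm.trans h0)
      have c1 := congrArg Complex.ofReal (hr1.symm.trans h10)
      have c2 := congrArg Complex.ofReal (hr2.symm.trans h2)
      push_cast at c0 c1 c2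
      by_contra hB0
      have m0 : (A 1 0 : ℂ) * eigenForm (B.map Complex.ofReal) w = 0 := by
        simp only [eigenForm, map_apply]
        linear_combination (B 1 0 : ℂ) * vA + w 0 * w 1 * c2 - w 1 ^ 2 * c1
      have m1 : ((A 1 1 : ℂ) - A 0 0) * eigenForm (B.map Complex.ofReal) w = 0 := by
        simp only [eigenForm, map_apply]
        linear_combination ((B 1 1 : ℂ) - B 0 0) * vA - w 0 ^ 2 * c2 + w 1 ^ 2 * c0
      have d := hA.discr_ne_zero h h1
      simp only [map_apply] at d
      apply d
      rw [(mul_eq_zero.1 m0).resolve_right hB0, (mul_eq_zero.1 m1).resolve_right hB0]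
      ring
    · refine fin ![0, 1] (fun h => by simpa using congrFun h 1) ?_ ?_
      · have : A 1 0 * r0 + (A 1 1 - A 0 0) * r1 - A 0 1 * r2 = 0 := by
          rw [hr0, hr1, hr2]; ring
        apply mul_left_cancel₀ h2
        simp only [eigenForm, Matrix.cons_val]
        linear_combination this - A 1 0 * h0 - (A 1 1 - A 0 0) * h10
      · have : B 1 0 * r0 + (B 1 1 - B 0 0) * r1 - B 0 1 * r2 = 0 := by
          rw [hr0, hr1, hr2]; ring
        apply mul_left_cancel₀ h2
        simp only [eigenForm, Matrix.cons_val]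
        linear_combination this - B 1 0 * h0 - (B 1 1 - B 0 0) * h10
  · refine fin ![r0, r1] (fun h => h0 (by simpa using congrFun h 0)) ?_ ?_
    · simp only [eigenForm, Matrix.cons_val]
      have : A 1 0 * r0 + (A 1 1 - A 0 0) * r1 - A 0 1 * r2 = 0 := by
        rw [hr0, hr1, hr2]; ring
      linear_combination r0 * this - A 0 1 * hr
    · simp only [eigenForm, Matrix.cons_val]
      have : B 1 0 * r0 + (B 1 1 - B 0 0) * r1 - B 0 1 * r2 = 0 := by
        rw [hr0, hr1, hr2]; ring
      linear_combination r0 * this - B 0 1 * hr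

end CubicPair

/-- Symmetric trilinear forms on complex four-space. -/
structure IsSymmTrilinear
    (T : (Fin 4 → ℂ) →ₗ[ℂ] (Fin 4 → ℂ) →ₗ[ℂ] (Fin 4 → ℂ) →ₗ[ℂ] ℂ) : Prop where
  symm_left : ∀ x y z, T x y z = T y x z
  symm_right : ∀ x y z, T x y z = T x z y

open MvPolynomial in
lemma exists_trilinear_of_isHomogeneous {G : MvPolynomial (Fin 4) ℂ} (hG : G.IsHomogeneous 3) :
    ∃ T : (Fin 4 → ℂ) →ₗ[ℂ] (Fin 4 → ℂ) →ₗ[ℂ] (Fin 4 → ℂ) →ₗ[ℂ] ℂ,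
      ∀ z, eval z G = T z z z ∧ ∀ j, eval z (pderiv j G) =
        T (Pi.single j 1) z z + T z (Pi.single j 1) z + T z z (Pi.single j 1) := by
  have hmono : ∀ d ∈ G.support,
      ∃ T : (Fin 4 → ℂ) →ₗ[ℂ] (Fin 4 → ℂ) →ₗ[ℂ] (Fin 4 → ℂ) →ₗ[ℂ] ℂ,
      ∀ z, eval z (monomial d (coeff d G)) = T z z z ∧
        ∀ j, eval z (pderiv j (monomial d (coeff d G))) =
        T (Pi.single j 1) z z + T z (Pi.single j 1) z + T z z (Pi.single j 1) := by
    intro d hd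
    have hdeg : d.degree = 3 := by
      have := hG (mem_support_iff.1 hd)
      exact (DFunLike.congr_fun Finsupp.degree_eq_weight_one d).trans this
    obtain ⟨a, b, c, habc⟩ := Multiset.card_eq_three.1
      ((Finsupp.card_toMultiset d).trans hdeg)
    have hd' : d = Finsupp.single a 1 + Finsupp.single b 1 + Finsupp.single c 1 := by
      rw [Finsupp.toMultiset_eq_iff.1 habc]
      simp [← Multiset.singleton_add, add_assoc]
    have hm : monomial d (coeff d G) = C (coeff d G) * (X a * X b * X c) := by
      conv_lhs => rw [← mul_one (coeff d G), ← C_mul_monomial]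
      conv_lhs => enter [2, 1]; rw [hd']
      simp [X, monomial_mul]
    rw [hm]
    generalize coeff d G = q
    refine ⟨q • (LinearMap.proj a : (Fin 4 → ℂ) →ₗ[ℂ] ℂ).smulRight
      ((LinearMap.proj b : (Fin 4 → ℂ) →ₗ[ℂ] ℂ).smulRight (LinearMap.proj c)),
      fun z => ⟨by simp [-mul_eq_mul_left_iff, mul_assoc], fun j => ?_⟩⟩
    simp [-mul_eq_mul_left_iff, Derivation.leibniz, pderiv_X, Pi.single_apply]
    split_ifs <;> simp [-mul_eq_mul_left_iff] <;> ring
  choose! T hT using hmono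
  refine ⟨∑ d ∈ G.support, T d, fun z => ⟨?_, fun j => ?_⟩⟩
  · conv_lhs => rw [G.as_sum]
    rw [map_sum]
    simp only [LinearMap.sum_apply]
    exact Finset.sum_congr rfl fun d hd => (hT d hd z).1
  · conv_lhs => rw [G.as_sum]
    rw [map_sum, map_sum]
    simp only [LinearMap.sum_apply]
    rw [← Finset.sum_add_distrib, ← Finset.sum_add_distrib]
    exact Finset.sum_congr rfl fun d hd => (hT d hd z).2 j

open MvPolynomial in
lemma exists_symmTrilinear_of_isHomogeneous {G : MvPolynomial (Fin 4) ℂ}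
    (hG : G.IsHomogeneous 3) : ∃ T, IsSymmTrilinear T ∧ (∀ z, eval z G = T z z z) ∧
      ∀ z, (∀ w, T z z w = 0) → ∀ j, eval z (pderiv j G) = 0 := by
  obtain ⟨T, hT⟩ := exists_trilinear_of_isHomogeneous hG
  let f := fun T : (Fin 4 → ℂ) →ₗ[ℂ] (Fin 4 → ℂ) →ₗ[ℂ] (Fin 4 → ℂ) →ₗ[ℂ] ℂ => T.flip
  let g := fun T : (Fin 4 → ℂ) →ₗ[ℂ] (Fin 4 → ℂ) →ₗ[ℂ] (Fin 4 → ℂ) →ₗ[ℂ] ℂ =>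
    (LinearMap.lflip (R₀ := ℂ)).toLinearMap ∘ₗ T
  let S := (1 / 6 : ℂ) • (T + f T + g T + f (g T) + g (f T) + f (g (f T)))
  have hS : ∀ x y z, S x y z =
      (1 / 6) * (T x y z + T y x z + T x z y + T y z x + T z x y + T z y x) := by
    intro x y z
    simp [S, f, g]
    ring
  refine ⟨S, ⟨fun x y z => ?_, fun x y z => ?_⟩, fun z => ?_, fun z hz j => ?_⟩
  · rw [hS, hS]; ring
  · rw [hS, hS]; ring
  · rw [hS, (hT z).1]; ring
  · rw [(hT z).2 j]
    have := hz (Pi.single j 1)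
    rw [hS] at this
    linear_combination 3 * this

lemma IsSymmTrilinear.apply_add {T} (hT : IsSymmTrilinear T) (x y : Fin 4 → ℂ) :
    T (x + y) (x + y) (x + y) = T x x x + 3 * T x x y + 3 * T x y y + T y y y := by
  simp only [map_add, LinearMap.add_apply]
  rw [hT.symm_left y x x, hT.symm_right x y x, hT.symm_right y y x, hT.symm_left y x y]
  ring

/-- The complexification of a real vector. -/
def toComplex (a : V4) : Fin 4 → ℂ := fun i => (a i : ℂ)

/-- The complex linear map spanned by a pair of real vectors. -/
noncomputable def pairMap (a b : V4) : (Fin 2 → ℂ) →ₗ[ℂ] (Fin 4 → ℂ) :=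
  (LinearMap.proj 0).smulRight (toComplex a) + (LinearMap.proj 1).smulRight (toComplex b)

lemma pairMap_apply (a b : V4) (u : Fin 2 → ℂ) :
    pairMap a b u = u 0 • toComplex a + u 1 • toComplex b := by
  simp [pairMap]

lemma IsSymmTrilinear.apply_pairMap {T} (hT : IsSymmTrilinear T) {a b : V4}
    (h : ∀ x ∈ span ℝ {a, b}, T (toComplex x) (toComplex x) (toComplex x) = 0)
    (u : Fin 2 → ℂ) : T (pairMap a b u) (pairMap a b u) (pairMap a b u) = 0 := by
  have key : ∀ s t : ℝ, T ((s : ℂ) • toComplex a + (t : ℂ) • toComplex b)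
      ((s : ℂ) • toComplex a + (t : ℂ) • toComplex b)
      ((s : ℂ) • toComplex a + (t : ℂ) • toComplex b) = 0 := by
    intro s t
    have := h (s • a + t • b) (mem_span_pair.2 ⟨s, t, rfl⟩)
    rwa [show toComplex (s • a + t • b) = (s : ℂ) • toComplex a + (t : ℂ) • toComplex b by
      ext i; simp [toComplex]] at this
  rw [pairMap_apply]
  have k1 := key 1 0
  have k2 := key 0 1
  have k3 := key 1 1
  have k4 := key 1 (-1)
  simp only [hT.apply_add, map_smul, LinearMap.smul_apply, smul_eq_mul] at k1 k2 k3 k4 ⊢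
  push_cast at k1 k2 k3 k4
  linear_combination u 0 ^ 3 * k1 + u 1 ^ 3 * k2 + u 0 ^ 2 * u 1 * (k3 / 2 - k4 / 2 - k2) +
    u 0 * u 1 ^ 2 * (k3 / 2 + k4 / 2 - k1)

lemma exists_pairMap_add {f : Fin 4 → V4} (hf : det2 (f 0) (f 1) (f 2) (f 3) ≠ 0)
    (z : Fin 4 → ℂ) : ∃ u v, z = pairMap (f 0) (f 1) u + pairMap (f 2) (f 3) v := by
  obtain ⟨p, hp⟩ := exists_comb_eq hf fun i => (z i).re
  obtain ⟨q, hq⟩ := exists_comb_eq hf fun i => (z i).im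
  refine ⟨![⟨p 0, q 0⟩, ⟨p 1, q 1⟩], ![⟨p 2, q 2⟩, ⟨p 3, q 3⟩], ?_⟩
  ext i
  have hp' := congrFun hp i
  have hq' := congrFun hq i
  rw [comb_apply] at hp' hq'
  rw [pairMap_apply, pairMap_apply]
  apply Complex.ext
  · simp [toComplex, ← hp']; ring
  · simp [toComplex, ← hq']; ring

lemma eq_zero_of_pairMap_add {f : Fin 4 → V4} (hf : det2 (f 0) (f 1) (f 2) (f 3) ≠ 0)
    {u v : Fin 2 → ℂ} (h : pairMap (f 0) (f 1) u + pairMap (f 2) (f 3) v = 0) :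
    u = 0 ∧ v = 0 := by
  rw [pairMap_apply, pairMap_apply] at h
  have hre : comb f ![(u 0).re, (u 1).re, (v 0).re, (v 1).re] = 0 := by
    ext i
    have := congrArg Complex.re (congrFun h i)
    simp [toComplex] at this
    simp [comb_apply]
    linarith
  have him : comb f ![(u 0).im, (u 1).im, (v 0).im, (v 1).im] = 0 := by
    ext i
    have := congrArg Complex.im (congrFun h i)
    simp [toComplex] at this
    simp [comb_apply]
    linarith
  have h1 := comb_eq_zero hf hre
  have h2 := comb_eq_zero hf him
  constructor
  · ext i
    fin_cases i
    · exact Complex.ext (by simpa using congrFun h1 0) (by simpa using congrFun h2 0)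
    · exact Complex.ext (by simpa using congrFun h1 1) (by simpa using congrFun h2 1)
  · ext i
    fin_cases i
    · exact Complex.ext (by simpa using congrFun h1 2) (by simpa using congrFun h2 2)
    · exact Complex.ext (by simpa using congrFun h1 3) (by simpa using congrFun h2 3)

/-- A frame of the graph of `M`, in the coordinates given by `f`. -/
def graphFrame (f : Fin 4 → V4) (M : Matrix (Fin 2) (Fin 2) ℝ) : V4 × V4 :=
  (f 0 + M 0 0 • f 2 + M 1 0 • f 3, f 1 + M 0 1 • f 2 + M 1 1 • f 3)

lemma det2_graphFrame (f : Fin 4 → V4) (M N : Matrix (Fin 2) (Fin 2) ℝ) :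
    det2 (graphFrame f M).1 (graphFrame f M).2 (graphFrame f N).1 (graphFrame f N).2 =
      (M - N).det * det2 (f 0) (f 1) (f 2) (f 3) := by
  have h (K : Matrix (Fin 2) (Fin 2) ℝ) : graphFrame f K =
      (comb f ![1, 0, K 0 0, K 1 0], comb f ![0, 1, K 0 1, K 1 1]) := by
    simp [graphFrame, comb]
  rw [h, h, det2_comb, Matrix.det_fin_two, det2_eq]
  simp
  left
  ring

lemma det2_graphFrame_eigenForm (f : Fin 4 → V4) (M : Matrix (Fin 2) (Fin 2) ℝ)
    (x : Fin 2 → ℝ) :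
    det2 (graphFrame f M).1 (graphFrame f M).2 (x 0 • f 0 + x 1 • f 1) (x 0 • f 2 + x 1 • f 3) =
      eigenForm M x * det2 (f 0) (f 1) (f 2) (f 3) := by
  have h1 : (graphFrame f M).1 = comb f ![1, 0, M 0 0, M 1 0] := by simp [graphFrame, comb]
  have h2 : (graphFrame f M).2 = comb f ![0, 1, M 0 1, M 1 1] := by simp [graphFrame, comb]
  have h3 : x 0 • f 0 + x 1 • f 1 = comb f ![x 0, x 1, 0, 0] := by simp [comb]
  have h4 : x 0 • f 2 + x 1 • f 3 = comb f ![0, 0, x 0, x 1] := by simp [comb]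
  rw [h1, h2, h3, h4, det2_comb, det2_eq, eigenForm]
  simp
  left
  ring

lemma exists_span_graphFrame {f : Fin 4 → V4} (hf : det2 (f 0) (f 1) (f 2) (f 3) ≠ 0)
    {P : PLine} (hP : Skew P (span ℝ {f 2, f 3})) :
    ∃ M, P = span ℝ {(graphFrame f M).1, (graphFrame f M).2} := by
  obtain ⟨a, b, rfl⟩ := exists_eq_span_pair hP.1
  have h := det2_ne_zero_of_inf_eq_bot hP.1 hP.2.1 hP.2.2
  obtain ⟨p, rfl⟩ := exists_comb_eq hf a
  obtain ⟨q, rfl⟩ := exists_comb_eq hf b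
  have hD : p 0 * q 1 - p 1 * q 0 ≠ 0 := by
    intro h0
    apply h
    have h2 : f 2 = comb f ![0, 0, 1, 0] := by simp [comb]
    have h3 : f 3 = comb f ![0, 0, 0, 1] := by simp [comb]
    rw [h2, h3, det2_comb, det2_eq]
    simp
    left
    linear_combination h0
  set D := p 0 * q 1 - p 1 * q 0 with hDdef
  refine ⟨!![(q 1 * p 2 - p 1 * q 2) / D, (p 0 * q 2 - q 0 * p 2) / D;
    (q 1 * p 3 - p 1 * q 3) / D, (p 0 * q 3 - q 0 * p 3) / D], ?_⟩
  have hdet : q 1 / D * (p 0 / D) - -(p 1) / D * (-(q 0) / D) ≠ 0 := by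
    rw [show q 1 / D * (p 0 / D) - -(p 1) / D * (-(q 0) / D) = D⁻¹ by
      field_simp; rw [hDdef]; ring]
    exact inv_ne_zero hD
  rw [← span_pair_lincomb hdet]
  congr 2
  · ext i
    simp [graphFrame, comb_apply]
    field_simp
    rw [hDdef]
    ring
  · congr 1
    ext i
    simp [graphFrame, comb_apply]
    field_simp
    rw [hDdef]
    ring

lemma det2_ne_zero_of_skew {a b c d : V4} (h : Skew (span ℝ {a, b}) (span ℝ {c, d})) :
    det2 a b c d ≠ 0 :=
  det2_ne_zero_of_inf_eq_bot h.1 h.2.1 h.2.2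

/-- Three pairwise skew lines are, in a suitable basis, the graphs of `0`, `∞` and the identity. -/
lemma exists_normalizing_basis {P Q R : PLine} (hPQ : Skew P Q) (hPR : Skew P R)
    (hQR : Skew Q R) : ∃ f : Fin 4 → V4, det2 (f 0) (f 1) (f 2) (f 3) ≠ 0 ∧
      P = span ℝ {f 0, f 1} ∧ Q = span ℝ {f 2, f 3} ∧
      R = span ℝ {(graphFrame f 1).1, (graphFrame f 1).2} := by
  obtain ⟨a, b, rfl⟩ := exists_eq_span_pair hPQ.1
  obtain ⟨c, d, rfl⟩ := exists_eq_span_pair hPQ.2.1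
  have hg := det2_ne_zero_of_skew hPQ
  obtain ⟨M, hM⟩ := exists_span_graphFrame (f := ![a, b, c, d]) hg
    (P := R) ⟨hQR.2.1, hQR.1, by rw [inf_comm]; exact hQR.2.2⟩
  have hM0 : M 0 0 * M 1 1 - M 1 0 * M 0 1 ≠ 0 := by
    have hz : graphFrame ![a, b, c, d] 0 = (a, b) := by simp [graphFrame]
    have := det2_graphFrame ![a, b, c, d] 0 M
    rw [hz] at this
    rw [hM] at hPR
    have h1 := det2_ne_zero_of_skew hPR
    rw [this, Matrix.det_fin_two] at h1
    intro h0
    apply h1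
    simp
    left
    linear_combination h0
  refine ⟨![a, b, M 0 0 • c + M 1 0 • d, M 0 1 • c + M 1 1 • d], ?_, rfl, ?_, ?_⟩
  · have := det2_lincomb a b c d 1 0 0 1 (M 0 0) (M 1 0) (M 0 1) (M 1 1)
    simp only [one_smul, zero_smul, add_zero, zero_add] at this
    simp only [Matrix.cons_val]
    rw [this]
    simp [sub_ne_zero] at hM0 ⊢
    exact ⟨hM0, hg⟩
  · exact (span_pair_lincomb hM0).symm
  · rw [hM]
    simp [graphFrame, add_assoc]

lemma IsSymmTrilinear.apply_self_self_eq_zero {T} (hT : IsSymmTrilinear T) {a b : V4}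
    (h : ∀ u, T (pairMap a b u) (pairMap a b u) (pairMap a b u) = 0) (x u : Fin 2 → ℂ) :
    T (pairMap a b x) (pairMap a b x) (pairMap a b u) = 0 := by
  have h1 := h (x + u)
  have h2 := h (x + (-1 : ℂ) • u)
  rw [(pairMap a b).map_add, hT.apply_add, h x, h u] at h1
  rw [(pairMap a b).map_add, hT.apply_add, h x] at h2
  simp only [map_smul, LinearMap.smul_apply, h u, smul_eq_mul] at h2
  linear_combination h1 / 6 - h2 / 6

/-- The part of a cubic form quadratic along the first plane and linear along the second. -/
noncomputable def mixedForm (T : (Fin 4 → ℂ) →ₗ[ℂ] (Fin 4 → ℂ) →ₗ[ℂ] (Fin 4 → ℂ) →ₗ[ℂ] ℂ)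
    (X Y Z : (Fin 2 → ℂ) →ₗ[ℂ] (Fin 4 → ℂ)) :
    (Fin 2 → ℂ) →ₗ[ℂ] (Fin 2 → ℂ) →ₗ[ℂ] (Fin 2 → ℂ) →ₗ[ℂ] ℂ :=
  (T.compl₁₂ X Y).compr₂ (LinearMap.lcomp ℂ ℂ Z)

lemma mixedForm_apply {T X Y Z} (x y z : Fin 2 → ℂ) :
    mixedForm T X Y Z x y z = T (X x) (Y y) (Z z) := by
  simp [mixedForm]

lemma pairMap_graphFrame (f : Fin 4 → V4) (M : Matrix (Fin 2) (Fin 2) ℝ) (u : Fin 2 → ℂ) :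
    pairMap (graphFrame f M).1 (graphFrame f M).2 u = pairMap (f 0) (f 1) u +
      pairMap (f 2) (f 3) ((M.map Complex.ofReal).mulVec u) := by
  ext i
  simp [pairMap_apply, graphFrame, toComplex]
  ring

open MvPolynomial in
/-- The mixed parts of the equation of a nonsingular cubic surface containing the lines spanned
by `f 0, f 1` and by `f 2, f 3`. -/
lemma exists_nonsingularCubic {F : MvPolynomial (Fin 4) ℝ} (hF : F.IsHomogeneous 3)
    (hsing : ∀ z : Fin 4 → ℂ, z ≠ 0 → eval z (map (algebraMap ℝ ℂ) F) = 0 →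
      ∃ j, eval z (map (algebraMap ℝ ℂ) (pderiv j F)) ≠ 0)
    {f : Fin 4 → V4} (hf : det2 (f 0) (f 1) (f 2) (f 3) ≠ 0)
    (h0 : ∀ x ∈ span ℝ {f 0, f 1}, eval x F = 0) (h1 : ∀ x ∈ span ℝ {f 2, f 3}, eval x F = 0) :
    ∃ Q R, NonsingularCubic Q R ∧ ∀ M : Matrix (Fin 2) (Fin 2) ℝ,
      (∀ x ∈ span ℝ {(graphFrame f M).1, (graphFrame f M).2}, eval x F = 0) →
        VanishesOn Q R (M.map Complex.ofReal) := by
  obtain ⟨T, hT, hTF, hTd⟩ := exists_symmTrilinear_of_isHomogeneous (hF.map (algebraMap ℝ ℂ))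
  have hreal (P : PLine) (hP : ∀ x ∈ P, eval x F = 0) : ∀ x ∈ P,
      T (toComplex x) (toComplex x) (toComplex x) = 0 := by
    intro x hx
    have := aeval_algebraMap_apply (B := ℂ) x F
    rw [← hTF, eval_map, ← aeval_def]
    refine this.trans ?_
    rw [aeval_eq_eval, hP x hx, map_zero]
  have hX := hT.apply_self_self_eq_zero (hT.apply_pairMap (hreal _ h0))
  have hY := hT.apply_self_self_eq_zero (hT.apply_pairMap (hreal _ h1))
  set X := pairMap (f 0) (f 1) with hXdef
  set Y := pairMap (f 2) (f 3) with hYdef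
  refine ⟨mixedForm T X X Y, mixedForm T X Y Y, ⟨fun x u y => ?_, fun x y v => ?_, ?_⟩, ?_⟩
  · simpa only [mixedForm_apply] using hT.symm_left _ _ _
  · simpa only [mixedForm_apply] using hT.symm_right _ _ _
  · intro x y hu hv
    simp only [mixedForm_apply] at hu hv
    have hz : ∀ w, T (X x + Y y) (X x + Y y) w = 0 := by
      intro w
      obtain ⟨u, v, rfl⟩ := exists_pairMap_add hf w
      rw [← hXdef, ← hYdef]
      simp only [map_add, LinearMap.add_apply]
      have e1 := hX x u
      have e2 := hY y v
      have e3 := hu u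
      have e4 := hv v
      rw [hT.symm_right (X x) (Y y) (X u), hT.symm_left (Y y) (X x) (X u),
        hT.symm_right (X x) (Y y) (X u), hT.symm_left (Y y) (X x) (Y v),
        hT.symm_right (Y y) (Y y) (X u), hT.symm_left (Y y) (X u) (Y y)]
      linear_combination e1 + e2 + e3 + e4
    refine eq_zero_of_pairMap_add hf ?_
    by_contra hne
    obtain ⟨j, hj⟩ := hsing _ hne (by rw [hTF]; exact hz _)
    exact hj (by rw [← pderiv_map]; exact hTd _ hz j)
  · intro M hM u
    have h := hT.apply_pairMap (hreal _ hM) u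
    rw [pairMap_graphFrame, hT.apply_add, ← hXdef, ← hYdef, hX, hY] at h
    simp only [mixedForm_apply]
    linear_combination h / 3

/-- Five of the six lines have a common transversal that misses the sixth. -/
lemma exists_transversal {L : Fin 6 → PLine} (hL : IsSchlafliSix L) :
    ∃ c d : V4, ∀ k, ∃ a b, L k = span ℝ {a, b} ∧ (det2 a b c d = 0 ↔ k ≠ 5) := by
  obtain ⟨hS, F, -, hF, hvan, hsing⟩ := hL
  obtain ⟨f, hf, h0, h1, h2⟩ := exists_normalizing_basis (hS 0 1 (by decide))
    (hS 0 2 (by decide)) (hS 1 2 (by decide))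
  have hg (k : Fin 6) (hk : k ≠ 1) :
      ∃ M, L k = span ℝ {(graphFrame f M).1, (graphFrame f M).2} :=
    exists_span_graphFrame hf (h1 ▸ hS k 1 hk)
  obtain ⟨A, hA⟩ := hg 3 (by decide)
  obtain ⟨B, hB⟩ := hg 4 (by decide)
  obtain ⟨C, hC⟩ := hg 5 (by decide)
  have h0' : L 0 = span ℝ {(graphFrame f 0).1, (graphFrame f 0).2} := by
    simpa [graphFrame] using h0
  obtain ⟨Q, R, hQR, hM⟩ := exists_nonsingularCubic hF hsing hf
    (fun x hx => hvan 0 x (h0 ▸ hx)) (fun x hx => hvan 1 x (h1 ▸ hx))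
  have hdet {k l : Fin 6} (hkl : k ≠ l) {M N : Matrix (Fin 2) (Fin 2) ℝ}
      (hk : L k = span ℝ {(graphFrame f M).1, (graphFrame f M).2})
      (hl : L l = span ℝ {(graphFrame f N).1, (graphFrame f N).2}) : (M - N).det ≠ 0 := by
    have h := hS k l hkl
    rw [hk, hl] at h
    have := det2_ne_zero_of_skew h
    rw [det2_graphFrame] at this
    exact left_ne_zero_of_mul this
  have hdetC {M : Matrix (Fin 2) (Fin 2) ℝ} (h : M.det ≠ 0) :
      (M.map Complex.ofReal).det ≠ 0 := by
    rw [show (M.map Complex.ofReal).det = (M.det : ℂ) from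
      (RingHom.map_det Complex.ofRealHom M).symm]
    exact_mod_cast h
  have hgl {k : Fin 6} (hk0 : k ≠ 0) (hk2 : k ≠ 2) {M : Matrix (Fin 2) (Fin 2) ℝ}
      (hk : L k = span ℝ {(graphFrame f M).1, (graphFrame f M).2}) :
      IsGraphLine Q R (M.map Complex.ofReal) := by
    refine ⟨hM M fun x hx => hvan k x (hk ▸ hx), hdetC ?_, ?_⟩
    · simpa using hdet hk0 hk h0'
    · have := hdetC (hdet hk2 hk h2)
      rwa [Matrix.map_sub _ Complex.ofReal_sub,
        Matrix.map_one _ Complex.ofReal_zero Complex.ofReal_one] at this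
  have hone : VanishesOn Q R 1 := by
    have := hM 1 fun x hx => hvan 2 x (h2 ▸ hx)
    rwa [Matrix.map_one _ Complex.ofReal_zero Complex.ofReal_one] at this
  obtain ⟨x, hxA, hxB, hxC⟩ := exists_real_common_zero hQR hone
    (hgl (by decide) (by decide) hA) (hgl (by decide) (by decide) hB)
    (hgl (by decide) (by decide) hC) (hdet (by decide) hA hB) (hdet (by decide) hA hC)
    (hdet (by decide) hB hC)
  have hzero {k : Fin 6} (hk5 : k ≠ 5) {M : Matrix (Fin 2) (Fin 2) ℝ}
      (hk : L k = span ℝ {(graphFrame f M).1, (graphFrame f M).2}) (h : eigenForm M x = 0) :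
      ∃ a b, L k = span ℝ {a, b} ∧
        (det2 a b (x 0 • f 0 + x 1 • f 1) (x 0 • f 2 + x 1 • f 3) = 0 ↔ k ≠ 5) :=
    ⟨_, _, hk, iff_of_true (by rw [det2_graphFrame_eigenForm, h, zero_mul]) hk5⟩
  refine ⟨x 0 • f 0 + x 1 • f 1, x 0 • f 2 + x 1 • f 3, fun k => ?_⟩
  fin_cases k
  · exact hzero (by decide) h0' (by simp [eigenForm])
  · refine ⟨_, _, h1, iff_of_true ?_ (by decide)⟩
    simp only [det2_eq, Pi.add_apply, Pi.smul_apply, smul_eq_mul]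
    ring
  · exact hzero (by decide) h2 (by simp [eigenForm])
  · exact hzero (by decide) hA hxA
  · exact hzero (by decide) hB hxB
  · refine ⟨_, _, hC, iff_of_false ?_ (by simp)⟩
    rw [det2_graphFrame_eigenForm]
    exact mul_ne_zero hxC hf

lemma det2_eq_zero_of_span_eq {a b a' b' c d : V4} (h : span ℝ {a, b} = span ℝ {a', b'})
    (h0 : det2 a b c d = 0) : det2 a' b' c d = 0 := by
  obtain ⟨s, t, rfl⟩ := mem_span_pair.1 (h ▸ subset_span (by simp) : a' ∈ span ℝ {a, b})
  obtain ⟨u, v, rfl⟩ := mem_span_pair.1 (h ▸ subset_span (by simp) : b' ∈ span ℝ {a, b})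
  have := det2_lincomb a b c d s t u v 1 0 0 1
  simp only [one_smul, zero_smul, add_zero, zero_add, h0, mul_zero] at this
  exact this

lemma PairwiseSkew.comp_injective {m n : ℕ} {L : Fin n → PLine} (hL : PairwiseSkew L)
    {g : Fin m → Fin n} (hg : Function.Injective g) : PairwiseSkew (L ∘ g) :=
  fun i j hij => hL (g i) (g j) (hg.ne hij)

lemma IsSchlafliSix.comp_perm {L : Fin 6 → PLine} (hL : IsSchlafliSix L)
    (σ : Equiv.Perm (Fin 6)) : IsSchlafliSix (L ∘ σ) := by
  obtain ⟨hS, F, hF0, hF, hvan, hsing⟩ := hL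
  exact ⟨hS.comp_injective σ.injective, F, hF0, hF, fun i => hvan (σ i), hsing⟩

/-- Every line of a Schläfli six has a partner meeting exactly the five other lines. -/
lemma IsSchlafliSix.exists_transversals {L : Fin 6 → PLine} (hL : IsSchlafliSix L) :
    ∃ a b c d : Fin 6 → V4, (∀ k, L k = span ℝ {a k, b k}) ∧
      ∀ k l, det2 (a k) (b k) (c l) (d l) = 0 ↔ k ≠ l := by
  have hab (k : Fin 6) : ∃ a b, L k = span ℝ {a, b} := by
    obtain ⟨j, hj⟩ := exists_ne k
    exact exists_eq_span_pair (hL.1 k j hj.symm).1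
  choose a b hab using hab
  have hcd (l : Fin 6) : ∃ c d : V4, ∀ k, det2 (a k) (b k) c d = 0 ↔ k ≠ l := by
    obtain ⟨c, d, h⟩ := exists_transversal (hL.comp_perm (Equiv.swap l 5))
    refine ⟨c, d, fun k => ?_⟩
    obtain ⟨a', b', hk, h'⟩ := h (Equiv.swap l 5 k)
    rw [Function.comp_apply, Equiv.swap_apply_self, hab k] at hk
    rw [show k ≠ l ↔ Equiv.swap l 5 k ≠ 5 by rw [Ne, Ne, Equiv.swap_apply_eq_iff,
      Equiv.swap_apply_right], ← h']
    exact ⟨det2_eq_zero_of_span_eq hk, det2_eq_zero_of_span_eq hk.symm⟩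
  choose c d hcd using hcd
  exact ⟨a, b, c, d, hab, fun k l => hcd l k⟩

lemma exists_perm_comp_succAbove (σ : Equiv.Perm (Fin 6)) (i : Fin 6) :
    ∃ p : Equiv.Perm (Fin 5), (σ i).succAbove = σ ∘ i.succAbove ∘ p := by
  have h (k : Fin 5) : ∃ m, i.succAbove m = σ.symm ((σ i).succAbove k) :=
    Fin.exists_succAbove_eq fun h =>
      Fin.succAbove_ne (σ i) k (σ.symm_apply_eq.1 h)
  choose p hp using h
  have hinj : Function.Injective p := fun k l hkl =>
    Fin.succAbove_right_injective (σ.symm.injective (by rw [← hp, ← hp, hkl]))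
  refine ⟨Equiv.ofBijective p (Finite.injective_iff_bijective.1 hinj), funext fun k => ?_⟩
  simp [hp]

theorem schlafli_homogeneous (L : Fin 6 → PLine) (hL : IsSchlafliSix L) (i j : Fin 6) :
    CoarseDeformEquiv (L ∘ i.succAbove) (L ∘ j.succAbove) := by
  rcases eq_or_ne i j with rfl | hij
  · exact coarseDeformEquiv_refl (hL.1.comp_injective Fin.succAbove_right_injective)
  obtain ⟨σ, h0, h1⟩ : ∃ σ : Equiv.Perm (Fin 6), σ 0 = i ∧ σ 1 = j := by
    have hm : Equiv.swap 0 i j ≠ 0 := by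
      rw [Ne, Equiv.swap_apply_eq_iff, Equiv.swap_apply_left]
      exact hij.symm
    exact ⟨(Equiv.swap 1 (Equiv.swap 0 i j)).trans (Equiv.swap 0 i),
      by simp [Equiv.swap_apply_of_ne_of_ne zero_ne_one hm.symm], by simp⟩
  obtain ⟨a, b, c, d, hab, hW⟩ := (hL.comp_perm σ).exists_transversals
  obtain ⟨p, hp⟩ := exists_perm_comp_succAbove σ 0
  obtain ⟨q, hq⟩ := exists_perm_comp_succAbove σ 1
  rw [h0] at hp
  rw [h1] at hq
  rw [hp, hq]
  exact coarseDeformEquiv_of_transversals (hL.comp_perm σ).1 hab hW p q
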